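/- arXiv:1503.05114 — 3 statements merged into one kernel-verified Lean document; each statement's English description precedes it below -/
import Mathlib

section
/- Let k be a field of characteristic p (p prime), c ≥ 1, and n ∈ ℕ with cp ≤ n ≤ (c+1)p − 1, and suppose n − cp + 1 ≤ a ≤ p − 1. Consider the twisted p-complex (Sym_n, D_a) with D_a(f) = ∂(f) + a·e_1·f, let B_c ⊂ Sym_n be the k-subalgebra generated by {e_{jp}^p : 1 ≤ j ≤ c}, and let W ⊆ Sym_n be the B_c-span of the monomials e_{cp}^{i_{cp}}·e_{cp+1}^{i_{cp+1}}⋯e_n^{i_n} with i_{cp} + i_{cp+1} + ⋯ + i_n = p − a. Then W is stable under D_a, and the inclusion (W, D_a) ↪ (Sym_n, D_a) is a quasi-isomorphism of p-complexes: for every s with 1 ≤ s ≤ p−1, (surjectivity) every f ∈ Sym_n with D_a^s f = 0 can be written f = w + D_a^{p−s}(h) with w ∈ W, D_a^s w = 0, and h ∈ Sym_n; and (injectivity) every w ∈ W with D_a^s w = 0 that lies in D_a^{p−s}(Sym_n) already lies in D_a^{p−s}(W). (This computes the cohomology of the rank-one p-DG module S_n(a) for n − cp + 1 ≤ a ≤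 p − 1.) -/
open MvPolynomial

section RelAcyclic

variable {k M : Type*} [Field k] [AddCommGroup M] [Module k M]

/-- For submodules `A ≤ B` stable under an endomorphism `δ` with `δ ^ p = 0`, the condition that the
`p`-complex `B / A` is acyclic. -/
def RelAcyclic (p : ℕ) (δ : Module.End k M) (A B : Submodule k M) : Prop :=
  ∀ f ∈ B, δ f ∈ A → ∃ g ∈ B, f - (δ ^ (p - 1)) g ∈ A

variable {p : ℕ} {δ : Module.End k M} {A B C : Submodule k M}

lemma pow_apply_mem_of_stable (hB : ∀ f ∈ B, δ f ∈ B) (r : ℕ) {f : M} (hf : f ∈ B) :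
    (δ ^ r) f ∈ B := by
  induction r with
  | zero => simpa
  | succ r ih => rw [pow_succ']; exact hB _ ih

lemma RelAcyclic.exists_sub_mem (h : RelAcyclic p δ A B) (hB : ∀ f ∈ B, δ f ∈ B) (s : ℕ)
    (hs : s ≤ p - 1) {f : M} (hf : f ∈ B) (hsf : (δ ^ s) f ∈ A) :
    ∃ g ∈ B, f - (δ ^ (p - s)) g ∈ A := by
  induction s generalizing f with
  | zero => exact ⟨0, B.zero_mem, by simpa using hsf⟩
  | succ s ih =>
    obtain ⟨g, hg, hgA⟩ := h _ (pow_apply_mem_of_stable hB s hf)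
      (by rwa [pow_succ', Module.End.mul_apply] at hsf)
    have e : p - 1 = s + (p - (s + 1)) := by omega
    obtain ⟨u, hu, huA⟩ := ih (f := f - (δ ^ (p - (s + 1))) g) (by omega)
      (B.sub_mem hf (pow_apply_mem_of_stable hB _ hg))
      (by rwa [map_sub, ← Module.End.mul_apply, ← pow_add, ← e])
    refine ⟨g + δ u, B.add_mem hg (hB _ hu), ?_⟩
    have e' : p - s = (p - (s + 1)) + 1 := by omega
    rw [e', pow_succ, Module.End.mul_apply] at huA
    rwa [map_add, ← sub_sub]

lemma RelAcyclic.refl (A : Submodule k M) : RelAcyclic p δ A A :=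
  fun f hf _ => ⟨0, A.zero_mem, by simpa⟩

lemma RelAcyclic.trans (hp : 1 ≤ p) (hδ : δ ^ p = 0) (hAB : A ≤ B) (hBC : B ≤ C)
    (h₁ : RelAcyclic p δ A B) (h₂ : RelAcyclic p δ B C) : RelAcyclic p δ A C := by
  intro f hf hfA
  obtain ⟨g, hg, hgB⟩ := h₂ f hf (hAB hfA)
  have hz : δ ((δ ^ (p - 1)) g) = 0 := by
    rw [← Module.End.mul_apply, ← pow_succ', Nat.sub_add_cancel hp, hδ, LinearMap.zero_apply]
  obtain ⟨u, hu, huA⟩ := h₁ _ hgB (by rwa [map_sub, hz, sub_zero])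
  exact ⟨g + u, C.add_mem hg (hBC hu), by rwa [map_add, ← sub_sub]⟩

lemma RelAcyclic.quotient (hp : 1 ≤ p) (hδ : δ ^ p = 0) (hAB : A ≤ B) (hBC : B ≤ C)
    (hB : ∀ f ∈ B, δ f ∈ B)
    (h₁ : RelAcyclic p δ A B) (h₂ : RelAcyclic p δ A C) : RelAcyclic p δ B C := by
  intro f hf hfB
  have hz : (δ ^ (p - 1)) (δ f) = 0 := by
    rw [← Module.End.mul_apply, ← pow_succ, Nat.sub_add_cancel hp, hδ, LinearMap.zero_apply]
  obtain ⟨b, hb, hbA⟩ := h₁.exists_sub_mem hB (p - 1) le_rfl hfB (by rw [hz]; exact A.zero_mem)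
  have e : p - (p - 1) = 1 := by omega
  rw [e, pow_one, ← map_sub] at hbA
  obtain ⟨g, hg, hgA⟩ := h₂ _ (C.sub_mem hf (hBC hb)) hbA
  refine ⟨g, hg, ?_⟩
  have := B.add_mem (hAB hgA) hb
  rwa [sub_right_comm, sub_add_cancel] at this

end RelAcyclic

open scoped TensorProduct in
/-- The `p`-th power of a derivation in characteristic `p` is additive over products. -/
lemma Derivation.pow_char_mul {k S : Type*} [Field k] [CommRing S] [Algebra k S] (p : ℕ)
    [Fact p.Prime] [CharP k p] (d : Derivation k S S) (f g : S) :
    ((d : Module.End k S) ^ p) (f * g)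
      = ((d : Module.End k S) ^ p) f * g + f * ((d : Module.End k S) ^ p) g := by
  let δ : Module.End k S := d
  let L : Module.End k (TensorProduct k S S) := TensorProduct.map δ LinearMap.id
  let R : Module.End k (TensorProduct k S S) := TensorProduct.map LinearMap.id δ
  have hL (r : ℕ) : (L ^ r) = TensorProduct.map (δ ^ r) LinearMap.id := by
    rw [TensorProduct.map_pow]; congr 1; exact one_pow r
  have hR (r : ℕ) : (R ^ r) = TensorProduct.map LinearMap.id (δ ^ r) := by
    rw [TensorProduct.map_pow]; congr 1; exact one_pow r
  have hc : Commute L R := by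
    ext x y; simp [L, R]
  have hm : ∀ r : ℕ, ∀ t,
      (δ ^ r) (LinearMap.mul' k S t) = LinearMap.mul' k S (((L + R) ^ r) t) := by
    intro r
    induction r with
    | zero => simp
    | succ r ih =>
      intro t
      rw [pow_succ, pow_succ, Module.End.mul_apply, Module.End.mul_apply, ← ih]
      congr 1
      induction t with
      | zero => simp
      | tmul x y => simp [L, R, δ]; ring
      | add x y hx hy => simp only [map_add, hx, hy]
  obtain ⟨r, hr⟩ := hc.exists_add_pow_prime_eq (Fact.out : p.Prime)
  have hp0 : (p : Module.End k (TensorProduct k S S)) = 0 := by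
    rw [← _root_.map_natCast (algebraMap k _), CharP.cast_eq_zero, map_zero]
  have key := hm p (f ⊗ₜ[k] g)
  rw [hr, hp0, hL, hR, zero_mul, zero_mul, zero_mul, add_zero] at key
  simpa using key

section MonomialSpan

variable {k : Type*} [Field k] {σ : Type*}

lemma mkDerivation_mem_restrictSupport (c : σ → k) (τ : σ → σ) (A B : Set (σ →₀ ℕ))
    (h : ∀ μ i, μ + Finsupp.single i 1 ∈ A → ((μ i + 1 : ℕ) : k) ≠ 0 → c i ≠ 0 →
      μ + Finsupp.single (τ i) 1 ∈ B)
    {f : MvPolynomial σ k} (hf : f ∈ restrictSupport k A) :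
    mkDerivation k (fun i => c i • (X (τ i) : MvPolynomial σ k)) f ∈ restrictSupport k B := by
  rw [restrictSupport_eq_span] at hf
  induction hf using Submodule.span_induction with
  | zero => simp
  | add x y _ _ hx hy => rw [map_add]; exact Submodule.add_mem _ hx hy
  | smul a x _ hx => rw [Derivation.map_smul]; exact Submodule.smul_mem _ _ hx
  | mem x hx =>
    obtain ⟨μ, hμ, rfl⟩ := hx
    rw [mkDerivation_monomial, one_smul]
    refine Submodule.sum_mem _ fun i _ => ?_
    simp only [X, smul_eq_mul, smul_monomial, monomial_mul, mul_one, monomial_mem_restrictSupport]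
    by_cases h1 : (μ i : k) = 0
    · simp [h1]
    by_cases h2 : c i = 0
    · simp [h2]
    have hi : μ i ≠ 0 := fun h0 => h1 (by simp [h0])
    have e : μ - Finsupp.single i 1 + Finsupp.single i 1 = μ :=
      tsub_add_cancel_of_le (by simpa using Nat.one_le_iff_ne_zero.2 hi)
    refine Or.inl (h _ i (by rwa [e]) ?_ h2)
    rwa [Finsupp.tsub_apply, Finsupp.single_eq_same, Nat.sub_add_cancel (by omega)]

lemma exists_add_of_mem_restrictSupport {A B : Set (σ →₀ ℕ)} {f : MvPolynomial σ k}
    (hf : f ∈ restrictSupport k (A ∪ B)) :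
    ∃ g ∈ restrictSupport k A, ∃ h ∈ restrictSupport k B, f = g + h := by
  rw [restrictSupport_eq_span, Set.image_union, Submodule.span_union, Submodule.mem_sup] at hf
  obtain ⟨g, hg, h, hh, e⟩ := hf
  exact ⟨g, by rwa [restrictSupport_eq_span], h, by rwa [restrictSupport_eq_span], e.symm⟩

lemma monomial_mul_mem_restrictSupport {A B : Set (σ →₀ ℕ)} {ν : σ →₀ ℕ} (h : ∀ μ ∈ A, ν + μ ∈ B)
    {f : MvPolynomial σ k} (hf : f ∈ restrictSupport k A) :
    monomial ν 1 * f ∈ restrictSupport k B := by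
  rw [restrictSupport_eq_span] at hf
  induction hf using Submodule.span_induction with
  | zero => simp
  | add x y _ _ hx hy => rw [mul_add]; exact Submodule.add_mem _ hx hy
  | smul a x _ hx => rw [mul_smul_comm]; exact Submodule.smul_mem _ _ hx
  | mem x hx =>
    obtain ⟨μ, hμ, rfl⟩ := hx
    simp [monomial_mul, h μ hμ]

lemma mem_restrictSupport_of_monomial_mul {A B : Set (σ →₀ ℕ)} {ν : σ →₀ ℕ}
    {f : MvPolynomial σ k} (hf : f ∈ restrictSupport k A)
    (hνf : monomial ν 1 * f ∈ restrictSupport k B) :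
    f ∈ restrictSupport k {μ | μ ∈ A ∧ ν + μ ∈ B} := by
  rw [mem_restrictSupport_iff] at *
  intro μ hμ
  refine ⟨hf hμ, hνf ?_⟩
  simpa [mem_support_iff, coeff_monomial_mul] using hμ

lemma exists_monomial_mul_of_mem_restrictSupport {A B : Set (σ →₀ ℕ)} {ν : σ →₀ ℕ}
    (h : ∀ μ ∈ B, ∃ μ' ∈ A, μ = ν + μ')
    {f : MvPolynomial σ k} (hf : f ∈ restrictSupport k B) :
    ∃ g ∈ restrictSupport k A, f = monomial ν 1 * g := by
  rw [restrictSupport_eq_span] at hf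
  induction hf using Submodule.span_induction with
  | zero => exact ⟨0, Submodule.zero_mem _, by simp⟩
  | add x y _ _ hx hy =>
    obtain ⟨g, hg, rfl⟩ := hx
    obtain ⟨g', hg', rfl⟩ := hy
    exact ⟨g + g', Submodule.add_mem _ hg hg', by rw [mul_add]⟩
  | smul a x _ hx =>
    obtain ⟨g, hg, rfl⟩ := hx
    exact ⟨a • g, Submodule.smul_mem _ _ hg, by rw [mul_smul_comm]⟩
  | mem x hx =>
    obtain ⟨μ, hμ, rfl⟩ := hx
    obtain ⟨μ', hμ', rfl⟩ := h μ hμ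
    exact ⟨monomial μ' 1, by simp [hμ'], by simp [monomial_mul]⟩

/-- Multiplication by a monomial transfers relative acyclicity between spans of monomials. -/
lemma RelAcyclic.monomial_mul {p : ℕ} (d : Derivation k (MvPolynomial σ k) (MvPolynomial σ k))
    (ν : σ →₀ ℕ) {A₁ B₁ A₂ B₂ : Set (σ →₀ ℕ)}
    (hB : ∀ μ ∈ B₁, ν + μ ∈ B₂) (hB' : ∀ μ ∈ B₂, μ ∈ A₂ ∨ ∃ μ' ∈ B₁, μ = ν + μ')
    (hA : ∀ μ ∈ B₁, ν + μ ∈ A₂ ↔ μ ∈ A₁) (hA₁ : A₁ ⊆ B₁)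
    (hν : ∀ f ∈ restrictSupport k B₁, f * d (monomial ν 1) ∈ restrictSupport k A₂)
    (hB₁ : ∀ f ∈ restrictSupport k B₁, d f ∈ restrictSupport k B₁)
    (hA₂ : ∀ f ∈ restrictSupport k A₂, d f ∈ restrictSupport k A₂)
    (h : RelAcyclic p (d : Module.End k (MvPolynomial σ k))
      (restrictSupport k A₁) (restrictSupport k B₁)) :
    RelAcyclic p (d : Module.End k (MvPolynomial σ k))
      (restrictSupport k A₂) (restrictSupport k B₂) := by
  set δ : Module.End k (MvPolynomial σ k) :=
    (d : MvPolynomial σ k →ₗ[k] MvPolynomial σ k)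
  have hd (f) : δ f = d f := rfl
  set u : MvPolynomial σ k := monomial ν 1
  intro f hf hfA
  obtain ⟨a, ha, b, hb, rfl⟩ := exists_add_of_mem_restrictSupport
    (restrictSupport_mono k (t := A₂ ∪ {μ | ∃ μ' ∈ B₁, μ = ν + μ'}) hB' hf)
  obtain ⟨f₁, hf₁, rfl⟩ := exists_monomial_mul_of_mem_restrictSupport
    (A := B₁) (fun μ hμ => hμ) hb
  have hcomm : ∀ g ∈ restrictSupport k B₁, δ (u * g) - u * δ g ∈ restrictSupport k A₂ := by
    intro g hg
    have := hν g hg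
    rw [hd, hd, Derivation.leibniz]
    simpa using this
  have h1 : u * d f₁ ∈ restrictSupport k A₂ := by
    have e : u * d f₁ = δ (a + u * f₁) - δ a - (δ (u * f₁) - u * δ f₁) := by
      rw [map_add]; simp only [hd]; ring
    rw [e]
    exact Submodule.sub_mem _ (Submodule.sub_mem _ hfA (hA₂ _ ha)) (hcomm _ hf₁)
  have h2 := mem_restrictSupport_of_monomial_mul (hB₁ _ hf₁) h1
  obtain ⟨g, hg, hgA⟩ := h f₁ hf₁ (restrictSupport_mono k (fun μ hμ => (hA μ hμ.1).1 hμ.2) h2)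
  have hpow : ∀ r, (δ ^ r) (u * g) - u * (δ ^ r) g ∈ restrictSupport k A₂ := by
    intro r
    induction r with
    | zero => simp
    | succ r ih =>
      have hr := pow_apply_mem_of_stable (δ := δ) hB₁ r hg
      have e : (δ ^ (r + 1)) (u * g) - u * (δ ^ (r + 1)) g
          = δ ((δ ^ r) (u * g) - u * (δ ^ r) g)
            + (δ (u * (δ ^ r) g) - u * δ ((δ ^ r) g)) := by
        rw [pow_succ', Module.End.mul_apply, Module.End.mul_apply, map_sub]; ring
      rw [e]
      exact Submodule.add_mem _ (hA₂ _ ih) (hcomm _ hr)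
  refine ⟨u * g, monomial_mul_mem_restrictSupport hB hg, ?_⟩
  have h3 : u * (f₁ - (δ ^ (p - 1)) g) ∈ restrictSupport k A₂ :=
    monomial_mul_mem_restrictSupport (fun μ hμ => (hA μ (hA₁ hμ)).2 hμ) hgA
  have e : a + u * f₁ - (δ ^ (p - 1)) (u * g)
      = a + u * (f₁ - (δ ^ (p - 1)) g) - ((δ ^ (p - 1)) (u * g) - u * (δ ^ (p - 1)) g) := by ring
  rw [e]
  exact Submodule.sub_mem _ (Submodule.add_mem _ ha h3) (hpow _)

end MonomialSpan

section ShiftDerivation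

variable (k : Type*) [Field k]

/-- The derivation of `k[X₀, X₁, …]` with `X i ↦ -(i + 1) X (i + 1)`. -/
noncomputable def shiftDerivation : Derivation k (MvPolynomial ℕ k) (MvPolynomial ℕ k) :=
  mkDerivation k fun i => (-((i + 1 : ℕ) : k)) • X (i + 1)

/-- The endomorphism of `k[X₀, X₁, …]` underlying `shiftDerivation`. -/
noncomputable abbrev shiftEnd : Module.End k (MvPolynomial ℕ k) :=
  (shiftDerivation k : MvPolynomial ℕ k →ₗ[k] MvPolynomial ℕ k)

/-- The derivation lowering by one the index of the variables `X i` with `j * p < i < (j + 1) * p`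
and killing all others. -/
noncomputable def lowerDerivation (p j : ℕ) :
    Derivation k (MvPolynomial ℕ k) (MvPolynomial ℕ k) :=
  mkDerivation k fun i => (if i / p = j ∧ i ≠ j * p then (1 : k) else 0) • X (i - 1)

/-- The derivation multiplying a monomial by its degree in the `j`-th block of variables. -/
noncomputable def blockEuler (p j : ℕ) :
    Derivation k (MvPolynomial ℕ k) (MvPolynomial ℕ k) :=
  mkDerivation k fun i => (if i / p = j then (1 : k) else 0) • X i

lemma shiftDerivation_X (i : ℕ) :
    shiftDerivation k (X i) = (-((i + 1 : ℕ) : k)) • (X (i + 1) : MvPolynomial ℕ k) :=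
  mkDerivation_X _ _ _

variable {k}
variable {p : ℕ}

lemma shiftEnd_pow_X (i r : ℕ) :
    (shiftEnd k ^ r) (X i)
      = (∏ t ∈ Finset.range r, -((i + t + 1 : ℕ) : k)) • (X (i + r) : MvPolynomial ℕ k) := by
  induction r with
  | zero => simp
  | succ r ih =>
    rw [pow_succ', Module.End.mul_apply, ih, map_smul, Finset.prod_range_succ, mul_smul]
    congr 1
    exact shiftDerivation_X k _

lemma shiftEnd_pow_char [Fact p.Prime] [CharP k p] : shiftEnd k ^ p = 0 := by
  have hp : p.Prime := Fact.out
  refine LinearMap.ext fun f => ?_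
  rw [LinearMap.zero_apply]
  induction f using MvPolynomial.induction_on with
  | C a =>
    rw [← Nat.sub_add_cancel hp.one_le, pow_succ, Module.End.mul_apply]
    have : shiftEnd k (C a) = 0 := derivation_C _ _
    rw [this, map_zero]
  | add f g hf hg => rw [map_add, hf, hg, add_zero]
  | mul_X f i hf =>
    rw [Derivation.pow_char_mul, hf, zero_mul, zero_add, shiftEnd_pow_X,
      Finset.prod_eq_zero (i := p - 1 - i % p), zero_smul, mul_zero]
    · have := hp.pos
      exact Finset.mem_range.2 (by omega)
    · rw [neg_eq_zero, CharP.cast_eq_zero_iff k p]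
      have := Nat.mod_lt i hp.pos
      refine ⟨i / p + 1, ?_⟩
      have := Nat.div_add_mod i p
      rw [mul_add]
      omega

/-- The multidegree of a monomial with respect to the blocks `{j * p, …, j * p + p - 1}`. -/
noncomputable def blockDeg (p : ℕ) (μ : ℕ →₀ ℕ) : ℕ →₀ ℕ := μ.mapDomain (· / p)

lemma blockDeg_add (μ ν : ℕ →₀ ℕ) : blockDeg p (μ + ν) = blockDeg p μ + blockDeg p ν :=
  Finsupp.mapDomain_add

lemma blockDeg_single (i r : ℕ) :
    blockDeg p (Finsupp.single i r) = Finsupp.single (i / p) r :=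
  Finsupp.mapDomain_single

lemma blockDeg_apply (μ : ℕ →₀ ℕ) (j : ℕ) :
    blockDeg p μ j = ∑ i ∈ μ.support, if i / p = j then μ i else 0 := by
  rw [blockDeg, Finsupp.mapDomain, Finsupp.sum, Finsupp.finsetSum_apply]
  simp [Finsupp.single_apply]

lemma blockDeg_apply_eq (μ : ℕ →₀ ℕ) {i : ℕ} (h : ∀ i', i' / p = i / p → i' ≠ i → μ i' = 0) :
    blockDeg p μ (i / p) = μ i := by
  rw [blockDeg_apply, Finset.sum_eq_single i]
  · simp
  · intro i' _ hi'
    split_ifs with h'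
    · exact h i' h' hi'
    · rfl
  · simp +contextual

lemma apply_le_blockDeg (μ : ℕ →₀ ℕ) (i : ℕ) : μ i ≤ blockDeg p μ (i / p) := by
  by_cases hi : μ i = 0
  · simp [hi]
  rw [blockDeg_apply]
  refine le_trans (by simp) (Finset.single_le_sum
    (f := fun i' => if i' / p = i / p then μ i' else 0)
    (fun _ _ => Nat.zero_le _) (Finsupp.mem_support_iff.2 hi))

lemma blockEuler_apply {j : ℕ} {d : ℕ →₀ ℕ} {f : MvPolynomial ℕ k}
    (hf : f ∈ restrictSupport k {μ | blockDeg p μ = d}) :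
    blockEuler k p j f = (d j : k) • f := by
  rw [restrictSupport_eq_span] at hf
  induction hf using Submodule.span_induction with
  | zero => simp
  | add x y _ _ hx hy => rw [map_add, hx, hy, smul_add]
  | smul a x _ hx => rw [Derivation.map_smul, hx, smul_comm]
  | mem x hx =>
    obtain ⟨μ, hμ, rfl⟩ := hx
    rw [blockEuler, mkDerivation_monomial, one_smul, ← (hμ : _ = d), blockDeg_apply, Finsupp.sum,
      Nat.cast_sum, Finset.sum_smul]
    refine Finset.sum_congr rfl fun i hi => ?_
    have e : μ - Finsupp.single i 1 + Finsupp.single i 1 = μ :=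
      tsub_add_cancel_of_le (by
        simpa using Nat.one_le_iff_ne_zero.2 (Finsupp.mem_support_iff.1 hi))
    split_ifs
    · simp only [X, smul_eq_mul, smul_monomial, monomial_mul, mul_one, e]
    · simp

lemma not_dvd_of_neg_cast_ne_zero [CharP k p] {i : ℕ} (h : -(i : k) ≠ 0) : ¬ p ∣ i := by
  rwa [neg_ne_zero, Ne, CharP.cast_eq_zero_iff k p] at h

lemma succ_div_of_not_dvd {i : ℕ} (h : ¬ p ∣ i + 1) : (i + 1) / p = i / p := by
  rw [Nat.succ_div, if_neg h, add_zero]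

lemma shiftDerivation_mem_restrictSupport [CharP k p] {A B : Set (ℕ →₀ ℕ)}
    (h : ∀ μ i, μ + Finsupp.single i 1 ∈ A → ¬ p ∣ μ i + 1 → ¬ p ∣ i + 1 →
      μ + Finsupp.single (i + 1) 1 ∈ B)
    {f : MvPolynomial ℕ k} (hf : f ∈ restrictSupport k A) :
    shiftDerivation k f ∈ restrictSupport k B := by
  refine mkDerivation_mem_restrictSupport _ _ A B (fun μ i hμ h1 h2 => ?_) hf
  exact h μ i hμ (by rwa [Ne, CharP.cast_eq_zero_iff k p] at h1) (not_dvd_of_neg_cast_ne_zero h2)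

lemma shiftDerivation_mem_blockDeg [CharP k p] (d : ℕ →₀ ℕ) :
    ∀ f ∈ restrictSupport k {μ | blockDeg p μ = d},
      shiftDerivation k f ∈ restrictSupport k {μ | blockDeg p μ = d} := by
  refine fun f hf => shiftDerivation_mem_restrictSupport (fun μ i hμ _ hi => ?_) hf
  simpa only [Set.mem_ofPred_eq, blockDeg_add, blockDeg_single, succ_div_of_not_dvd hi] using hμ

lemma commutator_shiftDerivation_lowerDerivation [Fact p.Prime] [CharP k p] (j : ℕ)
    (f : MvPolynomial ℕ k) :
    shiftDerivation k (lowerDerivation k p j f)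
      = lowerDerivation k p j (shiftDerivation k f) + blockEuler k p j f := by
  have hp : p.Prime := Fact.out
  have key : ⁅shiftDerivation k, lowerDerivation k p j⁆ = blockEuler k p j := by
    refine derivation_ext fun i => ?_
    rw [Derivation.commutator_apply, shiftDerivation_X, Derivation.map_smul]
    simp only [lowerDerivation, blockEuler, mkDerivation_X, Derivation.map_smul,
      shiftDerivation_X, add_tsub_cancel_right, smul_smul]
    have hcast : ∀ r : ℕ, p ∣ r → (r : k) = 0 := fun r => (CharP.cast_eq_zero_iff k p r).2
    rcases Nat.eq_zero_or_pos i with rfl | hi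
    · have h1 : 1 / p = 0 := Nat.div_eq_of_lt hp.one_lt
      by_cases hj : j = 0
      · subst hj; simp [h1]
      · simp [h1, Ne.symm hj]
    rw [Nat.sub_add_cancel hi, ← sub_smul]
    congr 1
    by_cases hd : p ∣ i + 1
    · have h1 : ¬ (i = j * p) := by
        rintro rfl
        exact hp.one_lt.ne' (Nat.dvd_one.1 ((Nat.dvd_add_right (Dvd.intro_left j rfl)).1 hd))
      have h2 : (i : k) + 1 = 0 := by exact_mod_cast hcast _ hd
      rw [hcast _ hd]
      by_cases hj : i / p = j
      · simp [hj, h1, eq_neg_of_add_eq_zero_left h2]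
      · simp [hj]
    · rw [succ_div_of_not_dvd hd]
      by_cases hj : i / p = j
      · have h1 : i + 1 ≠ j * p := fun h => hd ⟨j, by rw [h, mul_comm]⟩
        by_cases hi0 : i = j * p
        · simp [hi0, Nat.mul_div_cancel _ hp.pos]
        · simp [hj, h1, hi0]
      · simp [hj]
  rw [← key, Derivation.commutator_apply]
  ring

end ShiftDerivation

section Block

variable {k : Type*} [Field k] {p : ℕ}

/-- The exponents of the monomials in the ideal generated by `X b ^ p` and the variables in `Z`. -/
def idealExponents (p b : ℕ) (Z : Set ℕ) : Set (ℕ →₀ ℕ) :=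
  {μ | p ≤ μ b ∨ ∃ i ∈ Z, μ i ≠ 0}

/-- The exponents of block degree `d`. -/
def degExponents (p : ℕ) (d : ℕ →₀ ℕ) : Set (ℕ →₀ ℕ) := {μ | blockDeg p μ = d}

lemma mem_idealExponents_shift {b : ℕ} {Z : Set ℕ} (hZ : ∀ i ∈ Z, ¬ p ∣ i + 1 → i + 1 ∈ Z)
    {μ : ℕ →₀ ℕ} {i : ℕ} (hμ : μ + Finsupp.single i 1 ∈ idealExponents p b Z)
    (h1 : ¬ p ∣ μ i + 1) (h2 : ¬ p ∣ i + 1) :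
    μ + Finsupp.single (i + 1) 1 ∈ idealExponents p b Z := by
  rcases hμ with h | ⟨z, hz, h⟩
  · left
    simp only [Finsupp.add_apply, Finsupp.single_apply] at h ⊢
    by_cases hi : i = b
    · subst hi
      have : p ≠ μ i + 1 := fun h => h1 (h ▸ dvd_rfl)
      simp at h ⊢
      omega
    · simp [hi] at h
      omega
  · right
    by_cases hi : i = z
    · subst hi
      exact ⟨i + 1, hZ i hz h2, by simp⟩
    · refine ⟨z, hz, ?_⟩
      simp [hi] at h
      simp [h]

lemma shiftDerivation_mem_idealExponents [CharP k p] {b : ℕ} {Z : Set ℕ}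
    (hZ : ∀ i ∈ Z, ¬ p ∣ i + 1 → i + 1 ∈ Z) (d : ℕ →₀ ℕ) :
    ∀ f ∈ restrictSupport k (degExponents p d ∩ idealExponents p b Z),
      shiftDerivation k f ∈ restrictSupport k (degExponents p d ∩ idealExponents p b Z) := by
  intro f hf
  refine shiftDerivation_mem_restrictSupport (fun μ i hμ h1 h2 => ?_) hf
  refine ⟨?_, mem_idealExponents_shift hZ hμ.2 h1 h2⟩
  simpa only [degExponents, Set.mem_ofPred_eq, blockDeg_add, blockDeg_single,
    succ_div_of_not_dvd h2] using hμ.1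

lemma pred_div_eq {i j : ℕ} (h : i / p = j) (h' : i ≠ j * p) : (i - 1) / p = j := by
  rcases Nat.eq_zero_or_pos i with rfl | hi
  · exact h
  have : ¬ p ∣ (i - 1) + 1 := by
    rw [Nat.sub_add_cancel hi]
    intro hd
    exact h' (by rw [← h, Nat.div_mul_cancel hd])
  rw [← succ_div_of_not_dvd this, Nat.sub_add_cancel hi, h]

lemma lowerDerivation_mem_degExponents (j : ℕ) (d : ℕ →₀ ℕ) :
    ∀ f ∈ restrictSupport k (degExponents p d),
      lowerDerivation k p j f ∈ restrictSupport k (degExponents p d) := by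
  refine fun f hf => mkDerivation_mem_restrictSupport _ _ _ _ (fun μ i hμ _ h2 => ?_) hf
  obtain ⟨hj, hi⟩ : i / p = j ∧ i ≠ j * p := by by_contra h; simp [h] at h2
  simpa only [degExponents, Set.mem_ofPred_eq, blockDeg_add, blockDeg_single,
    pred_div_eq hj hi, hj] using hμ

lemma lowerDerivation_mem_idealExponents {j : ℕ} {Z : Set ℕ} (hZ : ∀ i ∈ Z, i / p ≠ j)
    (d : ℕ →₀ ℕ) :
    ∀ f ∈ restrictSupport k (degExponents p d ∩ idealExponents p (j * p) Z),
      lowerDerivation k p j f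
        ∈ restrictSupport k (degExponents p d ∩ idealExponents p (j * p) Z) := by
  refine fun f hf => mkDerivation_mem_restrictSupport _ _ _ _ (fun μ i hμ _ h2 => ?_) hf
  obtain ⟨hj, hi⟩ : i / p = j ∧ i ≠ j * p := by by_contra h; simp [h] at h2
  refine ⟨by simpa only [degExponents, Set.mem_ofPred_eq, blockDeg_add, blockDeg_single,
    pred_div_eq hj hi, hj] using hμ.1, ?_⟩
  rcases hμ.2 with h | ⟨z, hz, h⟩
  · left
    simp [hi] at h
    simp only [Finsupp.add_apply]
    omega
  · right
    have hiz : i ≠ z := by rintro rfl; exact hZ i hz hj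
    refine ⟨z, hz, ?_⟩
    simp [hiz] at h
    simp [h]

/-- If the degree in a full block is invertible, lowering the indices in that block provides a
contracting homotopy. -/
lemma relAcyclic_of_blockDeg_ne_zero [Fact p.Prime] [CharP k p] {j : ℕ} {Z : Set ℕ}
    (hZ : ∀ i ∈ Z, ¬ p ∣ i + 1 → i + 1 ∈ Z) (hZj : ∀ i ∈ Z, i / p ≠ j) {d : ℕ →₀ ℕ}
    (hd : (d j : k) ≠ 0) :
    RelAcyclic p (shiftEnd k) (restrictSupport k (degExponents p d ∩ idealExponents p (j * p) Z))
      (restrictSupport k (degExponents p d)) := by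
  set A := restrictSupport k (degExponents p d ∩ idealExponents p (j * p) Z)
  set B := restrictSupport k (degExponents p d)
  set δ := shiftEnd k
  set ξ : Module.End k (MvPolynomial ℕ k) :=
    (lowerDerivation k p j : MvPolynomial ℕ k →ₗ[k] MvPolynomial ℕ k)
  have hp : p.Prime := Fact.out
  have hA : ∀ f ∈ A, δ f ∈ A := shiftDerivation_mem_idealExponents hZ d
  have hξA : ∀ f ∈ A, ξ f ∈ A := lowerDerivation_mem_idealExponents hZj d
  have hξB : ∀ f ∈ B, ξ f ∈ B := lowerDerivation_mem_degExponents j d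
  have hcomm : ∀ f ∈ B, δ (ξ f) = ξ (δ f) + (d j : k) • f := fun f hf => by
    rw [← blockEuler_apply hf]
    exact commutator_shiftDerivation_lowerDerivation j f
  intro f hf hfA
  have h1 : ∀ r : ℕ, δ ((ξ ^ (r + 1)) f) - ((r + 1 : ℕ) * d j : k) • (ξ ^ r) f ∈ A := by
    intro r
    induction r with
    | zero =>
      have := hξA _ hfA
      simpa [hcomm f hf] using this
    | succ r ih =>
      have e : δ ((ξ ^ (r + 1 + 1)) f) - ((r + 1 + 1 : ℕ) * d j : k) • (ξ ^ (r + 1)) f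
          = ξ (δ ((ξ ^ (r + 1)) f) - ((r + 1 : ℕ) * d j : k) • (ξ ^ r) f) := by
        rw [pow_succ', Module.End.mul_apply, hcomm _ (pow_apply_mem_of_stable hξB _ hf), map_sub,
          map_smul, ← Module.End.mul_apply ξ (ξ ^ r), ← pow_succ', Nat.cast_succ (r + 1)]
        module
      rw [e]
      exact hξA _ ih
  have h2 : ∀ r : ℕ, (δ ^ r) ((ξ ^ r) f) - ((r.factorial : k) * (d j : k) ^ r) • f ∈ A := by
    intro r
    induction r with
    | zero => simp
    | succ r ih =>
      have e : (δ ^ (r + 1)) ((ξ ^ (r + 1)) f)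
            - (((r + 1).factorial : k) * (d j : k) ^ (r + 1)) • f
          = (δ ^ r) (δ ((ξ ^ (r + 1)) f) - ((r + 1 : ℕ) * d j : k) • (ξ ^ r) f)
            + ((r + 1 : ℕ) * d j : k) •
              ((δ ^ r) ((ξ ^ r) f) - ((r.factorial : k) * (d j : k) ^ r) • f) := by
        rw [pow_succ, Module.End.mul_apply, map_sub, map_smul, Nat.factorial_succ, Nat.cast_mul]
        module
      rw [e]
      exact A.add_mem (pow_apply_mem_of_stable hA _ (h1 r)) (A.smul_mem _ ih)
  have hu : ((p - 1).factorial : k) * (d j : k) ^ (p - 1) ≠ 0 := by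
    refine mul_ne_zero ?_ (pow_ne_zero _ hd)
    rw [Ne, CharP.cast_eq_zero_iff k p, hp.dvd_factorial]
    have := hp.pos
    omega
  refine ⟨(((p - 1).factorial : k) * (d j : k) ^ (p - 1))⁻¹ • (ξ ^ (p - 1)) f,
    B.smul_mem _ (pow_apply_mem_of_stable hξB _ hf), ?_⟩
  have := A.smul_mem (-(((p - 1).factorial : k) * (d j : k) ^ (p - 1))⁻¹) (h2 (p - 1))
  rw [smul_sub, smul_smul, neg_mul, inv_mul_cancel₀ hu] at this
  rw [map_smul]
  convert this using 1
  module

/-- The variables in `Z` together with those of the `j`-th block from position `m` on. -/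
def withTail (p j m : ℕ) (Z : Set ℕ) : Set ℕ := Z ∪ {i | j * p + m ≤ i ∧ i < j * p + p}

lemma withTail_shift {j m : ℕ} {Z : Set ℕ} (hZ : ∀ i ∈ Z, ¬ p ∣ i + 1 → i + 1 ∈ Z) :
    ∀ i ∈ withTail p j m Z, ¬ p ∣ i + 1 → i + 1 ∈ withTail p j m Z := by
  rintro i (hi | ⟨h1, h2⟩) hd
  · exact Or.inl (hZ i hi hd)
  · refine Or.inr ⟨by omega, lt_of_le_of_ne h2 fun h => hd ?_⟩
    rw [h]
    exact ⟨j + 1, by ring⟩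

lemma idealExponents_withTail_subset (j m : ℕ) (Z : Set ℕ) :
    idealExponents p (j * p) (withTail p j (m + 1) Z)
      ⊆ idealExponents p (j * p) (withTail p j m Z) := by
  rintro μ (h | ⟨i, hi | ⟨h1, h2⟩, h⟩)
  · exact Or.inl h
  · exact Or.inr ⟨i, Or.inl hi, h⟩
  · exact Or.inr ⟨i, Or.inr ⟨by omega, h2⟩, h⟩

lemma div_eq_of_mem_block {i j : ℕ} (h1 : j * p ≤ i) (h2 : i < j * p + p) : i / p = j :=
  Nat.div_eq_of_lt_le h1 (by rwa [Nat.succ_mul])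

/-- Adding one more variable of the `j`-th block to the ideal. -/
lemma RelAcyclic.withTail_succ [Fact p.Prime] [CharP k p] {j m : ℕ} {Z : Set ℕ} (hm : 1 ≤ m)
    (hmp : m < p) (hZ : ∀ i ∈ Z, ¬ p ∣ i + 1 → i + 1 ∈ Z) (hZj : ∀ i ∈ Z, i / p ≠ j)
    {d : ℕ →₀ ℕ}
    (h : RelAcyclic p (shiftEnd k)
      (restrictSupport k (degExponents p d ∩ idealExponents p (j * p) (withTail p j (m + 1) Z)))
      (restrictSupport k (degExponents p d))) :
    RelAcyclic p (shiftEnd k)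
      (restrictSupport k (degExponents p (d + Finsupp.single j 1) ∩
        idealExponents p (j * p) (withTail p j (m + 1) Z)))
      (restrictSupport k (degExponents p (d + Finsupp.single j 1) ∩
        idealExponents p (j * p) (withTail p j m Z))) := by
  have htj : (j * p + m) / p = j := div_eq_of_mem_block (by omega) (by omega)
  have htZ : j * p + m ∉ withTail p j (m + 1) Z := by
    rintro (h | ⟨h, -⟩)
    · exact hZj _ h htj
    · omega
  have hdeg : ∀ μ, blockDeg p (Finsupp.single (j * p + m) 1 + μ) = d + Finsupp.single j 1
      ↔ blockDeg p μ = d := fun μ => by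
    rw [blockDeg_add, blockDeg_single, htj, add_comm, add_left_inj]
  refine RelAcyclic.monomial_mul (shiftDerivation k) (Finsupp.single (j * p + m) 1)
    (A₁ := degExponents p d ∩ idealExponents p (j * p) (withTail p j (m + 1) Z))
    (B₁ := degExponents p d) ?_ ?_ ?_ Set.inter_subset_left ?_
    (shiftDerivation_mem_blockDeg d)
    (shiftDerivation_mem_idealExponents (withTail_shift hZ) _) h
  · intro μ hμ
    exact ⟨(hdeg μ).2 hμ, Or.inr ⟨j * p + m, Or.inr ⟨le_rfl, by omega⟩, by simp⟩⟩
  · rintro μ ⟨hμ, hμ'⟩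
    by_cases ht : μ (j * p + m) = 0
    · refine Or.inl ⟨hμ, ?_⟩
      rcases hμ' with h | ⟨i, hi, h⟩
      · exact Or.inl h
      · refine Or.inr ⟨i, ?_, h⟩
        rcases hi with hi | ⟨h1, h2⟩
        · exact Or.inl hi
        · refine Or.inr ⟨?_, h2⟩
          have : i ≠ j * p + m := by rintro rfl; exact h ht
          omega
    · have e : Finsupp.single (j * p + m) 1 + (μ - Finsupp.single (j * p + m) 1) = μ :=
        add_tsub_cancel_of_le (by simpa using Nat.one_le_iff_ne_zero.2 ht)
      exact Or.inr ⟨_, (hdeg _).1 (by rw [e]; exact hμ), e.symm⟩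
  · intro μ hμ
    simp only [Set.mem_inter_iff, degExponents, idealExponents, Set.mem_ofPred_eq, hdeg]
    refine and_congr_right fun _ => or_congr ?_ (exists_congr fun i => and_congr_right fun hi => ?_)
    · simp [Nat.one_le_iff_ne_zero.1 hm]
    · have : j * p + m ≠ i := by rintro rfl; exact htZ hi
      simp [this]
  · intro f hf
    change f * shiftDerivation k (X (j * p + m)) ∈ _
    rw [shiftDerivation_X, mul_smul_comm]
    by_cases hd : p ∣ j * p + m + 1
    · rw [(CharP.cast_eq_zero_iff k p _).2 hd]
      simp
    · refine Submodule.smul_mem _ _ ?_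
      rw [mul_comm f]
      refine monomial_mul_mem_restrictSupport (ν := Finsupp.single (j * p + m + 1) 1)
        (A := degExponents p d) (B := degExponents p (d + Finsupp.single j 1) ∩
          idealExponents p (j * p) (withTail p j (m + 1) Z)) (fun μ hμ => ?_) hf
      refine ⟨?_, Or.inr ⟨j * p + m + 1, ?_, ?_⟩⟩
      · simp only [degExponents, Set.mem_ofPred_eq, blockDeg_add, blockDeg_single,
          succ_div_of_not_dvd hd, htj]
        rw [add_comm, (hμ : _ = d)]
      · refine (withTail_shift (m := m) hZ _ (Or.inr ⟨le_rfl, by omega⟩) hd).imp id fun h => ?_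
        exact ⟨by omega, h.2⟩
      · simp

lemma relAcyclic_low_degree [Fact p.Prime] [CharP k p] {j : ℕ} {Z : Set ℕ}
    (hZ : ∀ i ∈ Z, ¬ p ∣ i + 1 → i + 1 ∈ Z) (hZj : ∀ i ∈ Z, i / p ≠ j) (l : ℕ) (hl : l + 1 ≤ p)
    (d : ℕ →₀ ℕ) (hd : l + 1 ≤ d j) (hd' : d j < p) :
    RelAcyclic p (shiftEnd k)
      (restrictSupport k (degExponents p d ∩ idealExponents p (j * p) (withTail p j (p - l) Z)))
      (restrictSupport k (degExponents p d)) := by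
  have hp : p.Prime := Fact.out
  induction l generalizing d with
  | zero =>
    refine relAcyclic_of_blockDeg_ne_zero (withTail_shift hZ) ?_ ?_
    · rintro i (hi | ⟨h1, h2⟩)
      · exact hZj i hi
      · omega
    · rw [Ne, CharP.cast_eq_zero_iff k p]
      exact Nat.not_dvd_of_pos_of_lt (by omega) hd'
  | succ l ih =>
    obtain ⟨d, rfl⟩ : ∃ d', d = d' + Finsupp.single j 1 :=
      ⟨d - Finsupp.single j 1, (tsub_add_cancel_of_le (by simp; omega)).symm⟩
    have e : p - l = p - (l + 1) + 1 := by omega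
    rw [e] at ih
    have hdj : (d + Finsupp.single j 1 : ℕ →₀ ℕ) j = d j + 1 := by simp
    have h1 := ih (by omega) d (by omega) (by omega)
    have h2 := ih (by omega) (d + Finsupp.single j 1) (by omega) hd'
    refine RelAcyclic.quotient hp.one_le shiftEnd_pow_char ?_ ?_ ?_
      (RelAcyclic.withTail_succ (by omega) (by omega) hZ hZj h1) h2
    · exact restrictSupport_mono k
        (Set.inter_subset_inter_right _ (idealExponents_withTail_subset _ _ _))
    · exact restrictSupport_mono k Set.inter_subset_left
    · exact shiftDerivation_mem_idealExponents (withTail_shift hZ) _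

/-- The `p`-complex of polynomials in a block of length `m`, modulo the `p`-th power of its first
variable, is acyclic in degrees at least `p - m + 1`. -/
theorem relAcyclic_block [Fact p.Prime] [CharP k p] {j : ℕ} {Z : Set ℕ}
    (hZ : ∀ i ∈ Z, ¬ p ∣ i + 1 → i + 1 ∈ Z) (hZj : ∀ i ∈ Z, i / p ≠ j) (m : ℕ) (hm : 1 ≤ m)
    (hmp : m ≤ p) (d : ℕ →₀ ℕ) (hd : p + 1 ≤ d j + m) :
    RelAcyclic p (shiftEnd k)
      (restrictSupport k (degExponents p d ∩ idealExponents p (j * p) (withTail p j m Z)))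
      (restrictSupport k (degExponents p d)) := by
  have hp : p.Prime := Fact.out
  have hj : j * p / p = j := Nat.mul_div_cancel _ hp.pos
  induction m, hm using Nat.le_induction generalizing d with
  | base =>
    have : degExponents p d ∩ idealExponents p (j * p) (withTail p j 1 Z) = degExponents p d := by
      refine Set.inter_eq_left.2 fun μ hμ => ?_
      by_contra hcon
      simp only [idealExponents, Set.mem_ofPred_eq, not_or, not_exists, not_and, not_not] at hcon
      have h1 := blockDeg_apply_eq (p := p) μ (i := j * p) fun i hi hi' => hcon.2 i <| by
        rw [hj] at hi
        have := Nat.div_add_mod i p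
        rw [hi, mul_comm] at this
        have := Nat.mod_lt i hp.pos
        exact Or.inr ⟨by omega, by omega⟩
      rw [(hμ : _ = d), hj] at h1
      omega
    rw [this]
    exact RelAcyclic.refl _
  | succ m hm ih =>
    induction hr : d j using Nat.strong_induction_on generalizing d with
    | _ r ihr =>
      subst hr
      by_cases hlow : d j = p - m
      · have := relAcyclic_low_degree (k := k) hZ hZj (p - (m + 1)) (by omega) d (by omega)
          (by omega)
        rwa [Nat.sub_sub_self hmp] at this
      · obtain ⟨d, rfl⟩ : ∃ d', d = d' + Finsupp.single j 1 :=
          ⟨d - Finsupp.single j 1, (tsub_add_cancel_of_le (by simp; omega)).symm⟩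
        have hdj : (d + Finsupp.single j 1 : ℕ →₀ ℕ) j = d j + 1 := by simp
        refine RelAcyclic.trans hp.one_le shiftEnd_pow_char ?_ ?_
          (RelAcyclic.withTail_succ hm (by omega) hZ hZj
            (ihr (d j) (by omega) d (by omega) rfl))
          (ih (by omega) (d + Finsupp.single j 1) (by omega))
        · exact restrictSupport_mono k
            (Set.inter_subset_inter_right _ (idealExponents_withTail_subset _ _ _))
        · exact restrictSupport_mono k Set.inter_subset_left

end Block

section Assembly

variable {k : Type*} [Field k] {p : ℕ}

/-- Relative acyclicity can be checked on the pieces of a grading by monomials. -/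
lemma RelAcyclic.of_fibers {σ ι : Type*} (φ : (σ →₀ ℕ) → ι) {δ : Module.End k (MvPolynomial σ k)}
    (A : Set (σ →₀ ℕ)) (Δ : Set ι)
    (hδ : ∀ d, ∀ f ∈ restrictSupport k {μ | φ μ = d}, δ f ∈ restrictSupport k {μ | φ μ = d})
    (h : ∀ d ∈ Δ, RelAcyclic p δ (restrictSupport k ({μ | φ μ = d} ∩ A))
      (restrictSupport k {μ | φ μ = d})) :
    RelAcyclic p δ (restrictSupport k ({μ | φ μ ∈ Δ} ∩ A)) (restrictSupport k {μ | φ μ ∈ Δ}) := by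
  classical
  intro f hf hfA
  set T := f.support.image φ
  set F : ι → MvPolynomial σ k := fun d => ∑ μ ∈ f.support with φ μ = d, monomial μ (coeff μ f)
  have hF : ∀ d, F d ∈ restrictSupport k {μ | φ μ = d} := fun d =>
    Submodule.sum_mem _ fun μ hμ => by simp [(Finset.mem_filter.1 hμ).2]
  have hsum : f = ∑ d ∈ T, F d := by
    conv_lhs => rw [f.as_sum]
    exact (Finset.sum_fiberwise_of_maps_to (fun μ hμ => Finset.mem_image_of_mem φ hμ) _).symm
  have hT : ∀ d ∈ T, d ∈ Δ := by
    intro d hd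
    obtain ⟨μ, hμ, rfl⟩ := Finset.mem_image.1 hd
    exact (mem_restrictSupport_iff k).1 hf hμ
  have hFA : ∀ d ∈ T, δ (F d) ∈ restrictSupport k ({μ | φ μ = d} ∩ A) := by
    intro d hd
    have h1 := hδ d _ (hF d)
    rw [mem_restrictSupport_iff] at h1 hfA ⊢
    intro μ hμ
    have hμd : φ μ = d := h1 hμ
    refine ⟨hμd, (hfA ?_).2⟩
    have : coeff μ (δ f) = coeff μ (δ (F d)) := by
      rw [hsum, map_sum, coeff_sum, Finset.sum_eq_single d _ (fun h => (h hd).elim)]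
      intro d' _ hd'
      by_contra hne
      have h2 := (mem_restrictSupport_iff k).1 (hδ d' _ (hF d')) (mem_support_iff.2 hne)
      exact hd' ((h2 : φ μ = d').symm.trans hμd)
    rw [Finset.mem_coe, mem_support_iff] at hμ ⊢
    rwa [this]
  choose! g hg hgA using fun d (hd : d ∈ T) => h d (hT d hd) (F d) (hF d) (hFA d hd)
  refine ⟨∑ d ∈ T, g d, Submodule.sum_mem _ fun d hd => ?_, ?_⟩
  · exact restrictSupport_mono k
      (fun μ hμ => by rw [Set.mem_ofPred_eq, (hμ : φ μ = d)]; exact hT d hd) (hg d hd)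
  · rw [map_sum, hsum, ← Finset.sum_sub_distrib]
    refine Submodule.sum_mem _ fun d hd => ?_
    exact restrictSupport_mono k (Set.inter_subset_inter_left _
      fun μ hμ => by rw [Set.mem_ofPred_eq, (hμ : φ μ = d)]; exact hT d hd) (hgA d hd)

/-- The exponents of the monomials involving a variable of index greater than `n`. -/
def tailExponents (n : ℕ) : Set (ℕ →₀ ℕ) := {μ | ∃ i, n < i ∧ μ i ≠ 0}

/-- The exponents of the monomials spanning the small subcomplex: a monomial of degree `p - a` in
the variables of index between `c * p` and `n`, times `p`-th powers of `X (j * p)` for `j ≤ c`. -/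
inductive CoreExponent (p c n a : ℕ) : (ℕ →₀ ℕ) → Prop
  | base (μ : ℕ →₀ ℕ) (h : ∀ i, μ i ≠ 0 → c * p ≤ i ∧ i ≤ n) (hdeg : μ.degree = p - a) :
      CoreExponent p c n a μ
  | step (j : ℕ) (μ : ℕ →₀ ℕ) (hj : j ≤ c) (h : CoreExponent p c n a μ) :
      CoreExponent p c n a (μ + Finsupp.single (j * p) p)

variable {c n a : ℕ}

lemma CoreExponent.dvd_degree {μ : ℕ →₀ ℕ} (h : CoreExponent p c n a μ) (ha : a ≤ p) :
    p ∣ μ.degree + a := by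
  induction h with
  | base μ _ hdeg => rw [hdeg, Nat.sub_add_cancel ha]
  | step j μ _ _ ih =>
    rw [map_add, Finsupp.degree_single, add_right_comm]
    exact dvd_add ih dvd_rfl

lemma CoreExponent.of_add_single {j : ℕ} {μ : ℕ →₀ ℕ} (hp : 0 < p) (ha : 1 ≤ a)
    (h : CoreExponent p c n a (μ + Finsupp.single (j * p) p)) : CoreExponent p c n a μ := by
  generalize hν : μ + Finsupp.single (j * p) p = ν at h
  induction h generalizing μ with
  | base ν _ hdeg =>
    rw [← hν, map_add, Finsupp.degree_single] at hdeg
    omega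
  | step j' ν hj' h ih =>
    by_cases hjj : j = j'
    · subst hjj
      rwa [add_right_cancel hν]
    · have hne : j * p ≠ j' * p := fun h => hjj (Nat.eq_of_mul_eq_mul_right hp h)
      have hle : Finsupp.single (j * p) p ≤ ν := by
        have := DFunLike.congr_fun hν (j * p)
        simp [hne.symm] at this
        simp [← this]
      obtain ⟨ν, rfl⟩ := exists_add_of_le hle
      have e : μ = ν + Finsupp.single (j' * p) p := by
        refine add_right_cancel (b := Finsupp.single (j * p) p) (hν.trans ?_)
        abel
      rw [e]
      exact .step _ _ hj' (ih (add_comm _ _))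

lemma CoreExponent.le_or_blockDeg_eq {μ : ℕ →₀ ℕ} (h : CoreExponent p c n a μ) (hp : 0 < p)
    (hnc : n < c * p + p) {j : ℕ} (hj : j ≤ c) :
    p ≤ μ (j * p) ∨ blockDeg p μ j = if j = c then p - a else 0 := by
  induction h with
  | base μ h hdeg =>
    right
    have e : blockDeg p μ = Finsupp.single c (p - a) := by
      have h1 : ∀ i ∈ μ.support, Finsupp.single (i / p) (μ i) = Finsupp.single c (μ i) := by
        intro i hi
        obtain ⟨h1, h2⟩ := h i (Finsupp.mem_support_iff.1 hi)
        rw [div_eq_of_mem_block h1 (by omega)]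
      rw [blockDeg, Finsupp.mapDomain, Finsupp.sum, Finset.sum_congr rfl h1,
        ← Finsupp.single_finsetSum, ← hdeg, Finsupp.degree_apply]
    rw [e, Finsupp.single_apply]
    simp [eq_comm]
  | step j' μ hj' h ih =>
    by_cases hjj : j' = j
    · subst hjj
      simp
    · have hne : j' * p ≠ j * p := fun h => hjj (Nat.eq_of_mul_eq_mul_right hp h)
      rw [blockDeg_add, blockDeg_single, Nat.mul_div_cancel _ hp]
      simpa [hne, hjj] using ih

/-- The exponents of the monomials vanishing in the quotient by the small subcomplex. -/
def smallExponents (p c n a : ℕ) : Set (ℕ →₀ ℕ) := {μ | CoreExponent p c n a μ} ∪ tailExponents n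

lemma tailExponents_add {μ : ℕ →₀ ℕ} (h : μ ∈ tailExponents n) (ν : ℕ →₀ ℕ) :
    μ + ν ∈ tailExponents n := by
  obtain ⟨i, hi, h⟩ := h
  exact ⟨i, hi, by simp [h]⟩

lemma smallExponents_step {j : ℕ} (hj : j ≤ c) {μ : ℕ →₀ ℕ} (h : μ ∈ smallExponents p c n a) :
    μ + Finsupp.single (j * p) p ∈ smallExponents p c n a :=
  h.imp (CoreExponent.step j μ hj) fun h => tailExponents_add h _

lemma tailExponents_shift {μ : ℕ →₀ ℕ} {i : ℕ} (h : μ + Finsupp.single i 1 ∈ tailExponents n) :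
    μ + Finsupp.single (i + 1) 1 ∈ tailExponents n := by
  obtain ⟨z, hz, h⟩ := h
  by_cases hi : i = z
  · exact ⟨i + 1, by omega, by simp⟩
  · exact ⟨z, hz, by simp [hi] at h; simp [h]⟩

lemma CoreExponent.shift {μ : ℕ →₀ ℕ} {i : ℕ}
    (h : CoreExponent p c n a (μ + Finsupp.single i 1)) (h1 : ¬ p ∣ μ i + 1) :
    μ + Finsupp.single (i + 1) 1 ∈ smallExponents p c n a := by
  generalize hν : μ + Finsupp.single i 1 = ν at h
  induction h generalizing μ with
  | base ν h hdeg =>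
    subst hν
    have hi := h i (by simp)
    by_cases hin : i = n
    · exact Or.inr ⟨i + 1, by omega, by simp⟩
    · refine Or.inl (.base _ (fun z hz => ?_) (by simpa using hdeg))
      by_cases hz' : z = i + 1
      · omega
      · refine h z ?_
        simp [Ne.symm hz'] at hz
        simp [hz]
  | step j ν hj h ih =>
    have hν' := DFunLike.congr_fun hν i
    have hle : Finsupp.single i 1 ≤ ν := by
      simp only [Finsupp.add_apply, Finsupp.single_eq_same, Finsupp.single_apply] at hν'
      rw [Finsupp.single_le_iff, Nat.one_le_iff_ne_zero]
      intro h0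
      rw [h0] at hν'
      split_ifs at hν'
      · exact h1 (by rw [hν']; simp)
    obtain ⟨ν, rfl⟩ := exists_add_of_le hle
    obtain rfl : μ = ν + Finsupp.single (j * p) p := by
      refine add_right_cancel (b := Finsupp.single i 1) (hν.trans ?_)
      abel
    rw [add_right_comm]
    refine smallExponents_step hj (ih (fun hd => h1 ?_) (add_comm _ _))
    simp only [Finsupp.add_apply, Finsupp.single_apply]
    split_ifs
    · rw [add_right_comm]
      exact dvd_add hd dvd_rfl
    · simpa using hd

lemma shiftDerivation_mem_smallExponents [CharP k p] (d : ℕ →₀ ℕ) :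
    ∀ f ∈ restrictSupport k (degExponents p d ∩ smallExponents p c n a),
      shiftDerivation k f ∈ restrictSupport k (degExponents p d ∩ smallExponents p c n a) := by
  intro f hf
  refine shiftDerivation_mem_restrictSupport (fun μ i hμ h1 h2 => ?_) hf
  refine ⟨?_, ?_⟩
  · simpa only [degExponents, Set.mem_ofPred_eq, blockDeg_add, blockDeg_single,
      succ_div_of_not_dvd h2] using hμ.1
  · exact hμ.2.elim (fun h => h.shift h1) fun h => Or.inr (tailExponents_shift h)

lemma relAcyclic_of_relAcyclic_idealExponents [Fact p.Prime] [CharP k p] (hcn : c * p ≤ n)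
    (hnc : n < c * p + p) (ha : 1 ≤ a) {j : ℕ} (hj : j ≤ c) {d : ℕ →₀ ℕ}
    (hd : (if j = c then p - a else 0) < d j)
    (hrel : RelAcyclic p (shiftEnd k)
      (restrictSupport k (degExponents p d ∩ idealExponents p (j * p) {i | n < i}))
      (restrictSupport k (degExponents p d)))
    (ih : ∀ d', d = d' + Finsupp.single j p → RelAcyclic p (shiftEnd k)
      (restrictSupport k (degExponents p d' ∩ smallExponents p c n a))
      (restrictSupport k (degExponents p d'))) :
    RelAcyclic p (shiftEnd k)
      (restrictSupport k (degExponents p d ∩ smallExponents p c n a))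
      (restrictSupport k (degExponents p d)) := by
  have hp : p.Prime := Fact.out
  have hjp : j * p / p = j := Nat.mul_div_cancel _ hp.pos
  have hjn : j * p ≤ n := (Nat.mul_le_mul_right p hj).trans hcn
  have hsub : degExponents p d ∩ smallExponents p c n a
      ⊆ degExponents p d ∩ idealExponents p (j * p) {i | n < i} := by
    rintro μ ⟨hμ, h | h⟩
    · refine ⟨hμ, Or.inl ((h.le_or_blockDeg_eq hp.pos hnc hj).resolve_right fun h => ?_)⟩
      rw [(hμ : _ = d)] at h
      omega
    · exact ⟨hμ, Or.inr h⟩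
  refine RelAcyclic.trans hp.one_le shiftEnd_pow_char (restrictSupport_mono k hsub)
    (restrictSupport_mono k Set.inter_subset_left) ?_ hrel
  by_cases hdp : p ≤ d j
  · obtain ⟨d, rfl⟩ : ∃ d', d = d' + Finsupp.single j p :=
      ⟨d - Finsupp.single j p, (tsub_add_cancel_of_le (by simpa using hdp)).symm⟩
    have hdeg : ∀ μ, blockDeg p (Finsupp.single (j * p) p + μ) = d + Finsupp.single j p
        ↔ blockDeg p μ = d := fun μ => by
      rw [blockDeg_add, blockDeg_single, hjp, add_comm, add_left_inj]
    refine RelAcyclic.monomial_mul (shiftDerivation k) (Finsupp.single (j * p) p)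
      (A₁ := degExponents p d ∩ smallExponents p c n a) (B₁ := degExponents p d) ?_ ?_ ?_
      Set.inter_subset_left ?_ (shiftDerivation_mem_blockDeg d)
      (shiftDerivation_mem_smallExponents _) (ih d rfl)
    · exact fun μ hμ => ⟨(hdeg μ).2 hμ, Or.inl (by simp)⟩
    · rintro μ ⟨hμ, h | h⟩
      · have e : Finsupp.single (j * p) p + (μ - Finsupp.single (j * p) p) = μ :=
          add_tsub_cancel_of_le (by simpa using h)
        exact Or.inr ⟨_, (hdeg _).1 (by rw [e]; exact hμ), e.symm⟩
      · exact Or.inl ⟨hμ, Or.inr h⟩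
    · intro μ hμ
      refine and_congr (hdeg μ) ⟨fun h => ?_, fun h => ?_⟩
      · refine h.imp (fun h => ?_) fun ⟨i, hi, h⟩ => ⟨i, hi, ?_⟩
        · exact CoreExponent.of_add_single hp.pos ha (by rwa [add_comm])
        · have : j * p ≠ i := by omega
          simpa [this] using h
      · rw [add_comm]
        exact smallExponents_step hj h
    · intro f _
      have e : (monomial (Finsupp.single (j * p) p) 1 : MvPolynomial ℕ k) = X (j * p) ^ p := by
        rw [X_pow_eq_monomial]
      rw [e, Derivation.leibniz_pow]
      simp [← Nat.cast_smul_eq_nsmul k]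
  · have : degExponents p d ∩ idealExponents p (j * p) {i | n < i}
        = degExponents p d ∩ smallExponents p c n a := by
      refine Set.Subset.antisymm ?_ hsub
      rintro μ ⟨hμ, h | h⟩
      · have := apply_le_blockDeg (p := p) μ (j * p)
        rw [(hμ : _ = d), hjp] at this
        omega
      · exact ⟨hμ, Or.inr h⟩
    rw [this]
    exact RelAcyclic.refl _

lemma blockDeg_degree (μ : ℕ →₀ ℕ) : (blockDeg p μ).degree = μ.degree := by
  simp only [blockDeg, Finsupp.mapDomain, Finsupp.sum, map_sum, Finsupp.degree_single]
  rw [Finsupp.degree_apply]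

theorem relAcyclic_smallExponents_of_blockDeg [Fact p.Prime] [CharP k p] (hcn : c * p ≤ n)
    (hna : n + 1 ≤ c * p + a) (ha : a < p) (d : ℕ →₀ ℕ)
    (hd : p ∣ d.degree + a) :
    RelAcyclic p (shiftEnd k)
      (restrictSupport k (degExponents p d ∩ smallExponents p c n a))
      (restrictSupport k (degExponents p d)) := by
  have hp : p.Prime := Fact.out
  induction hN : d.degree using Nat.strong_induction_on generalizing d with
  | _ N ihN =>
    subst hN
    have ih : ∀ j d', d = d' + Finsupp.single j p → RelAcyclic p (shiftEnd k)
        (restrictSupport k (degExponents p d' ∩ smallExponents p c n a))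
        (restrictSupport k (degExponents p d')) := by
      rintro j d' rfl
      rw [map_add, Finsupp.degree_single] at ihN hd
      refine ihN _ (by have := hp.pos; omega) d' ?_ rfl
      rw [add_right_comm] at hd
      exact (Nat.dvd_add_left dvd_rfl).1 hd
    by_cases hlow : ∃ j < c, d j ≠ 0
    · obtain ⟨j, hj, hdj⟩ := hlow
      refine relAcyclic_of_relAcyclic_idealExponents hcn (by omega) (by omega) hj.le
        (by rw [if_neg hj.ne]; omega) ?_ (ih j)
      have e : withTail p j p {i | n < i} = {i | n < i} := by
        ext i
        simp only [withTail, Set.mem_union, Set.mem_ofPred_eq]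
        omega
      have := relAcyclic_block (k := k) (p := p) (j := j) (Z := {i | n < i})
        (fun i hi _ => Nat.lt_succ_of_lt hi) (fun i hi hij => ?_) p hp.one_le le_rfl d (by omega)
      · rwa [e] at this
      · have h1 : c * p ≤ i := hcn.trans (le_of_lt hi)
        have := (Nat.le_div_iff_mul_le hp.pos).2 h1
        omega
    push Not at hlow
    by_cases hhigh : p + 1 ≤ d c + (n - c * p + 1)
    · refine relAcyclic_of_relAcyclic_idealExponents hcn (by omega) (by omega) le_rfl
        (by rw [if_pos rfl]; omega) ?_ (ih c)
      have e : withTail p c (n - c * p + 1) {i | c * p + p ≤ i} = {i | n < i} := by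
        ext i
        simp only [withTail, Set.mem_union, Set.mem_ofPred_eq]
        omega
      have := relAcyclic_block (k := k) (p := p) (j := c) (Z := {i | c * p + p ≤ i})
        (fun i hi _ => Nat.le_succ_of_le hi) (fun i hi hij => ?_) (n - c * p + 1) (by omega)
        (by omega) d hhigh
      · rwa [e] at this
      · have h1 : (c + 1) * p ≤ i := by rw [Nat.succ_mul]; exact hi
        have := (Nat.le_div_iff_mul_le hp.pos).2 h1
        omega
    · have : degExponents p d ∩ smallExponents p c n a = degExponents p d := by
        refine Set.inter_eq_left.2 fun μ hμ => ?_
        by_cases htail : μ ∈ tailExponents n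
        · exact Or.inr htail
        have hsupp : ∀ i, μ i ≠ 0 → c * p ≤ i ∧ i ≤ n := by
          intro i hi
          have hin : i ≤ n := by
            by_contra hcon
            exact htail ⟨i, by omega, hi⟩
          refine ⟨(Nat.le_div_iff_mul_le hp.pos).1 ?_, hin⟩
          by_contra hcon
          have h1 := apply_le_blockDeg (p := p) μ i
          rw [(hμ : _ = d), hlow _ (by omega)] at h1
          omega
        have hdc : d.degree = d c := by
          have h1 : blockDeg p μ c = μ.degree := by
            rw [blockDeg_apply, Finsupp.degree_apply]
            refine Finset.sum_congr rfl fun i hi => if_pos ?_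
            obtain ⟨h1, h2⟩ := hsupp i (Finsupp.mem_support_iff.1 hi)
            exact div_eq_of_mem_block h1 (by omega)
          rw [← blockDeg_degree (p := p), (hμ : _ = d)] at h1
          exact h1.symm
        refine Or.inl (.base _ hsupp ?_)
        rw [← blockDeg_degree (p := p), (hμ : _ = d), hdc]
        rw [hdc] at hd
        obtain ⟨q, hq⟩ := hd
        have h2 : q = 1 := by
          have h3 : p * q < p * 2 := by omega
          have h4 : 0 < p * q := by omega
          have := Nat.lt_of_mul_lt_mul_left h3
          have := Nat.pos_of_mul_pos_left h4
          omega
        subst h2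
        omega
      rw [this]
      exact RelAcyclic.refl _

/-- The monomials of degree `N ≡ -a` modulo the small ones form an acyclic `p`-complex. -/
theorem relAcyclic_smallExponents [Fact p.Prime] [CharP k p] (hcn : c * p ≤ n)
    (hna : n + 1 ≤ c * p + a) (ha : a < p) {N : ℕ} (hN : p ∣ N + a) :
    RelAcyclic p (shiftEnd k)
      (restrictSupport k ({μ | μ.degree = N} ∩ smallExponents p c n a))
      (restrictSupport k {μ | μ.degree = N}) := by
  have h := RelAcyclic.of_fibers (k := k) (p := p) (δ := shiftEnd k) (blockDeg p)
    (smallExponents p c n a) {d | d.degree = N} shiftDerivation_mem_blockDeg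
    fun d hd => relAcyclic_smallExponents_of_blockDeg hcn hna ha d (by rwa [(hd : _ = N)])
  simpa only [Set.mem_ofPred_eq, blockDeg_degree] using h

end Assembly

section EsymmEval

variable {k : Type*} [Field k]

lemma esymm_fin_eq_zero {n i : ℕ} (h : n < i) : esymm (Fin n) k i = 0 := by
  rw [esymm, Finset.powersetCard_eq_empty.2 (by simpa using h), Finset.sum_empty]

lemma sum_sum_compl_powersetCard {σ : Type*} [Fintype σ] [DecidableEq σ] (i : ℕ) :
    ∑ t ∈ Finset.powersetCard i (Finset.univ : Finset σ), ∑ x ∈ tᶜ,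
        X x * ∏ y ∈ t, (X y : MvPolynomial σ k)
      = ((i + 1 : ℕ) : MvPolynomial σ k) * esymm σ k (i + 1) := by
  have h : ((i + 1 : ℕ) : MvPolynomial σ k) * esymm σ k (i + 1)
      = ∑ s ∈ Finset.powersetCard (i + 1) (Finset.univ : Finset σ), ∑ x ∈ s,
        ∏ y ∈ s, (X y : MvPolynomial σ k) := by
    rw [esymm, Finset.mul_sum]
    refine Finset.sum_congr rfl fun s hs => ?_
    rw [Finset.sum_const, (Finset.mem_powersetCard.1 hs).2, nsmul_eq_mul]
  rw [h, Finset.sum_sigma', Finset.sum_sigma']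
  refine Finset.sum_bij' (fun q _ => ⟨insert q.2 q.1, q.2⟩) (fun q _ => ⟨q.1.erase q.2, q.2⟩)
    ?_ ?_ ?_ ?_ ?_
  · rintro ⟨t, x⟩ hq
    simp only [Finset.mem_sigma, Finset.mem_powersetCard_univ, Finset.mem_compl] at hq ⊢
    exact ⟨by rw [Finset.card_insert_of_notMem hq.2, hq.1], Finset.mem_insert_self _ _⟩
  · rintro ⟨t, x⟩ hq
    simp only [Finset.mem_sigma, Finset.mem_powersetCard_univ, Finset.mem_compl] at hq ⊢
    exact ⟨by rw [Finset.card_erase_of_mem hq.2, hq.1, Nat.add_sub_cancel],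
      Finset.notMem_erase _ _⟩
  · rintro ⟨t, x⟩ hq
    simp only [Finset.mem_sigma, Finset.mem_powersetCard_univ, Finset.mem_compl] at hq
    simp [Finset.erase_insert hq.2]
  · rintro ⟨t, x⟩ hq
    simp only [Finset.mem_sigma, Finset.mem_powersetCard_univ] at hq
    simp [Finset.insert_erase hq.2]
  · rintro ⟨t, x⟩ hq
    simp only [Finset.mem_sigma, Finset.mem_powersetCard_univ, Finset.mem_compl] at hq
    simp [Finset.prod_insert hq.2]

lemma derivation_esymm {σ : Type*} [Fintype σ]
    (D : Derivation k (MvPolynomial σ k) (MvPolynomial σ k)) (hD : ∀ i, D (X i) = X i ^ 2)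
    (i : ℕ) :
    D (esymm σ k i) = esymm σ k 1 * esymm σ k i
      - ((i + 1 : ℕ) : MvPolynomial σ k) * esymm σ k (i + 1) := by
  classical
  have hprod : ∀ t : Finset σ, D (∏ y ∈ t, X y) = ∑ x ∈ t, X x * ∏ y ∈ t, X y := by
    intro t
    induction t using Finset.induction_on with
    | empty => simp
    | insert x t hx ih =>
      rw [Finset.prod_insert hx, Derivation.leibniz, ih, hD, Finset.sum_insert hx,
        ← Finset.sum_mul, ← Finset.sum_mul]
      simp only [smul_eq_mul]
      ring
  rw [← sum_sum_compl_powersetCard, eq_sub_iff_add_eq, esymm_one, esymm, map_sum, Finset.mul_sum,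
    ← Finset.sum_add_distrib]
  refine Finset.sum_congr rfl fun t _ => ?_
  rw [hprod, Finset.sum_add_sum_compl, Finset.sum_mul]

variable (k)

/-- The evaluation of the variable `X i` at the `i`-th elementary symmetric polynomial. -/
noncomputable def esymmEval (n : ℕ) : MvPolynomial ℕ k →ₐ[k] MvPolynomial (Fin n) k :=
  aeval fun i => esymm (Fin n) k i

variable {k} {n : ℕ}

lemma esymmEval_X (i : ℕ) : esymmEval k n (X i) = esymm (Fin n) k i := aeval_X _ _

lemma esymmEval_single (i r : ℕ) :
    esymmEval k n (monomial (Finsupp.single i r) 1) = esymm (Fin n) k i ^ r := by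
  rw [← X_pow_eq_monomial, map_pow, esymmEval_X]

lemma esymmEval_monomial_add (μ ν : ℕ →₀ ℕ) :
    esymmEval k n (monomial (μ + ν) 1)
      = esymmEval k n (monomial μ 1) * esymmEval k n (monomial ν 1) := by
  rw [← map_mul, monomial_mul, one_mul]

/-- The twisted differential `f ↦ D f + a e₁ f`. -/
noncomputable def twistedEnd (D : Derivation k (MvPolynomial (Fin n) k) (MvPolynomial (Fin n) k))
    (a : ℕ) : Module.End k (MvPolynomial (Fin n) k) :=
  (D : MvPolynomial (Fin n) k →ₗ[k] MvPolynomial (Fin n) k) +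
    LinearMap.mulLeft k ((a : MvPolynomial (Fin n) k) * esymm (Fin n) k 1)

variable {D : Derivation k (MvPolynomial (Fin n) k) (MvPolynomial (Fin n) k)}

lemma twistedEnd_apply (a : ℕ) (f : MvPolynomial (Fin n) k) :
    twistedEnd D a f = D f + (a : MvPolynomial (Fin n) k) * (esymm (Fin n) k 1 * f) := by
  rw [← mul_assoc]
  rfl

lemma derivation_esymmEval_monomial (hD : ∀ i, D (X i) = X i ^ 2) (μ : ℕ →₀ ℕ) :
    D (esymmEval k n (monomial μ 1)) = esymmEval k n (shiftDerivation k (monomial μ 1))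
      + (μ.degree : MvPolynomial (Fin n) k) *
        (esymm (Fin n) k 1 * esymmEval k n (monomial μ 1)) := by
  induction μ using Finsupp.induction_linear with
  | zero => simp
  | add μ ν hμ hν =>
    have e : (monomial (μ + ν) 1 : MvPolynomial ℕ k) = monomial μ 1 * monomial ν 1 := by
      rw [monomial_mul, one_mul]
    rw [e, map_mul, Derivation.leibniz, Derivation.leibniz, hμ, hν]
    simp only [smul_eq_mul, map_add, map_mul, Nat.cast_add]
    ring
  | single i r =>
    rw [← X_pow_eq_monomial, map_pow, Derivation.leibniz_pow, Derivation.leibniz_pow,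
      esymmEval_X, derivation_esymm D hD, shiftDerivation_X, Finsupp.degree_single]
    rcases Nat.eq_zero_or_pos r with rfl | hr
    · simp
    obtain ⟨r, rfl⟩ := Nat.exists_eq_add_of_lt hr
    simp only [zero_add, Nat.add_sub_cancel, smul_eq_mul, nsmul_eq_mul, map_mul, map_natCast,
      map_pow, esymmEval_X, smul_eq_C_mul, map_neg, neg_mul]
    ring

lemma twistedEnd_esymmEval {p a : ℕ} [CharP k p] (hD : ∀ i, D (X i) = X i ^ 2) {N : ℕ}
    (hN : p ∣ N + a) {f : MvPolynomial ℕ k} (hf : f ∈ restrictSupport k {μ | μ.degree = N}) :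
    twistedEnd D a (esymmEval k n f) = esymmEval k n (shiftEnd k f) := by
  rw [restrictSupport_eq_span] at hf
  induction hf using Submodule.span_induction with
  | zero => simp
  | add x y _ _ hx hy => simp only [map_add, hx, hy]
  | smul r x _ hx => simp only [map_smul, hx]
  | mem x hx =>
    obtain ⟨μ, hμ, rfl⟩ := hx
    have h0 : ((N + a : ℕ) : MvPolynomial (Fin n) k) = 0 := by
      rw [← map_natCast (C : k →+* _), (CharP.cast_eq_zero_iff k p _).2 hN, map_zero]
    rw [twistedEnd_apply, derivation_esymmEval_monomial hD, (hμ : _ = N), add_assoc, ← add_mul,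
      ← Nat.cast_add, h0, zero_mul, add_zero]
    rfl

lemma shiftEnd_mem_degree : ∀ {N : ℕ}, ∀ f ∈ restrictSupport k {μ : ℕ →₀ ℕ | μ.degree = N},
    shiftEnd k f ∈ restrictSupport k {μ : ℕ →₀ ℕ | μ.degree = N} := by
  intro N f hf
  refine mkDerivation_mem_restrictSupport _ _ _ _ (fun μ i hμ _ _ => ?_) hf
  simpa only [Set.mem_ofPred_eq, map_add, Finsupp.degree_single] using hμ

lemma twistedEnd_pow_esymmEval {p a : ℕ} [CharP k p] (hD : ∀ i, D (X i) = X i ^ 2) {N : ℕ}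
    (hN : p ∣ N + a) (r : ℕ) {f : MvPolynomial ℕ k}
    (hf : f ∈ restrictSupport k {μ | μ.degree = N}) :
    (twistedEnd D a ^ r) (esymmEval k n f) = esymmEval k n ((shiftEnd k ^ r) f) := by
  induction r with
  | zero => simp
  | succ r ih =>
    rw [pow_succ', Module.End.mul_apply, ih, twistedEnd_esymmEval hD hN
      (pow_apply_mem_of_stable shiftEnd_mem_degree r hf), pow_succ', Module.End.mul_apply]

lemma esymmEval_eq_zero_of_mem_tailExponents {f : MvPolynomial ℕ k}
    (hf : f ∈ restrictSupport k (tailExponents n)) : esymmEval k n f = 0 := by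
  rw [restrictSupport_eq_span] at hf
  induction hf using Submodule.span_induction with
  | zero => simp
  | add x y _ _ hx hy => rw [map_add, hx, hy, add_zero]
  | smul r x _ hx => rw [map_smul, hx, smul_zero]
  | mem x hx =>
    obtain ⟨μ, ⟨i, hi, hμ⟩, rfl⟩ := hx
    rw [esymmEval, aeval_monomial, Finsupp.prod,
      Finset.prod_eq_zero (Finsupp.mem_support_iff.2 hμ), mul_zero]
    rw [esymm_fin_eq_zero hi, zero_pow hμ]

variable (k n) in
/-- Setting `X 0 = 1` and `X i = 0` for `i > n`. -/
noncomputable def dehomogenize : MvPolynomial ℕ k →ₐ[k] MvPolynomial (Fin n) k :=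
  aeval fun i => if i = 0 then 1 else if h : i - 1 < n then X ⟨i - 1, h⟩ else 0

lemma esymmAlgHom_dehomogenize (f : MvPolynomial ℕ k) :
    (esymmAlgHom (Fin n) k n (dehomogenize k n f) : MvPolynomial (Fin n) k) = esymmEval k n f := by
  rw [esymmAlgHom_apply, ← AlgHom.comp_apply]
  congr 1
  refine algHom_ext fun i => ?_
  rw [AlgHom.comp_apply, dehomogenize, aeval_X, esymmEval_X]
  split_ifs with h0 h
  · rw [h0, esymm_zero, map_one]
  · rw [aeval_X]
    congr 1
    simp only
    omega
  · rw [map_zero, esymm_fin_eq_zero (by omega)]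

/-- The dehomogenization of an exponent. -/
noncomputable def dropZero (n : ℕ) (μ : ℕ →₀ ℕ) : Fin n →₀ ℕ :=
  Finsupp.equivFunOnFinite.symm fun i => μ (i + 1)

lemma dropZero_add (μ ν : ℕ →₀ ℕ) : dropZero n (μ + ν) = dropZero n μ + dropZero n ν := by
  ext i
  simp [dropZero]

lemma dehomogenize_monomial {μ : ℕ →₀ ℕ} (h : μ ∉ tailExponents n) :
    dehomogenize k n (monomial μ 1) = monomial (dropZero n μ) 1 := by
  induction μ using Finsupp.induction_linear with
  | zero =>
    have : dropZero n 0 = 0 := by ext i; simp [dropZero]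
    simp [this]
  | add μ ν hμ hν =>
    have e : (monomial (μ + ν) 1 : MvPolynomial ℕ k) = monomial μ 1 * monomial ν 1 := by
      rw [monomial_mul, one_mul]
    rw [e, map_mul, hμ fun h' => h (tailExponents_add h' _),
      hν fun h' => h (by rw [add_comm]; exact tailExponents_add h' _), monomial_mul, one_mul,
      dropZero_add]
  | single i r =>
    rcases Nat.eq_zero_or_pos r with rfl | hr
    · have : dropZero n 0 = 0 := by ext i; simp [dropZero]
      simp [this]
    have hi : i ≤ n := by
      by_contra hcon
      exact h ⟨i, by omega, by simp; omega⟩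
    rw [← X_pow_eq_monomial, map_pow, dehomogenize, aeval_X]
    rcases i with - | i
    · have : dropZero n (Finsupp.single 0 r) = 0 := by ext i; simp [dropZero]
      simp [this]
    · have hi' : i < n := hi
      have : dropZero n (Finsupp.single (i + 1) r) = Finsupp.single ⟨i, hi'⟩ r := by
        ext z
        simp [dropZero, Finsupp.single_apply, Fin.ext_iff]
      simp [this, hi', X_pow_eq_monomial]

lemma dropZero_injOn {N : ℕ} {μ ν : ℕ →₀ ℕ} (hμ : μ ∉ tailExponents n) (hν : ν ∉ tailExponents n)
    (hμN : μ.degree = N) (hνN : ν.degree = N) (h : dropZero n μ = dropZero n ν) : μ = ν := by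
  have hsucc : ∀ i, μ (i + 1) = ν (i + 1) := by
    intro i
    by_cases hi : i < n
    · simpa [dropZero] using DFunLike.congr_fun h ⟨i, hi⟩
    · have h1 : μ (i + 1) = 0 := by by_contra hc; exact hμ ⟨i + 1, by omega, hc⟩
      have h2 : ν (i + 1) = 0 := by by_contra hc; exact hν ⟨i + 1, by omega, hc⟩
      rw [h1, h2]
  have herase : μ.erase 0 = ν.erase 0 := by
    ext i
    rcases i with - | i
    · simp
    · simpa using hsucc i
  have h1 := congrArg Finsupp.degree (Finsupp.single_add_erase 0 μ)
  have h2 := congrArg Finsupp.degree (Finsupp.single_add_erase 0 ν)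
  rw [map_add, Finsupp.degree_single, hμN, herase] at h1
  rw [map_add, Finsupp.degree_single, hνN] at h2
  have h0 : μ 0 = ν 0 := by omega
  rw [← Finsupp.single_add_erase 0 μ, ← Finsupp.single_add_erase 0 ν, herase, h0]

lemma mem_tailExponents_of_esymmEval_eq_zero {N : ℕ} {f : MvPolynomial ℕ k}
    (hf : f ∈ restrictSupport k {μ | μ.degree = N}) (h0 : esymmEval k n f = 0) :
    f ∈ restrictSupport k (tailExponents n) := by
  classical
  obtain ⟨g, hg, h, hh, rfl⟩ := exists_add_of_mem_restrictSupport (f := f)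
    (A := {μ | μ.degree = N ∧ μ ∉ tailExponents n}) (B := tailExponents n)
    (restrictSupport_mono k (fun μ hμ => (em (μ ∈ tailExponents n)).symm.imp_left
      fun h => ⟨hμ, h⟩) hf)
  rw [map_add, esymmEval_eq_zero_of_mem_tailExponents hh, add_zero,
    ← esymmAlgHom_dehomogenize] at h0
  have h1 : dehomogenize k n g = 0 :=
    esymmAlgHom_fin_injective k le_rfl (by rw [map_zero]; exact Subtype.ext h0)
  rw [mem_restrictSupport_iff] at hg
  have h2 : dehomogenize k n g = ∑ μ ∈ g.support, monomial (dropZero n μ) (coeff μ g) := by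
    conv_lhs => rw [g.as_sum, map_sum]
    refine Finset.sum_congr rfl fun μ hμ => ?_
    have e : monomial μ (coeff μ g) = coeff μ g • monomial μ (1 : k) := by
      rw [smul_monomial, smul_eq_mul, mul_one]
    rw [e, map_smul, dehomogenize_monomial (hg hμ).2, smul_monomial, smul_eq_mul, mul_one]
  have hg0 : g = 0 := by
    ext ν
    by_contra hν
    have hν' : ν ∈ g.support := mem_support_iff.2 hν
    have h3 := congrArg (coeff (dropZero n ν)) (h2.symm.trans h1)
    rw [coeff_sum, Finset.sum_eq_single ν, coeff_monomial, if_pos rfl] at h3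
    · exact hν h3
    · intro μ hμ hne
      rw [coeff_monomial, if_neg]
      exact fun e => hne (dropZero_injOn (hg hμ).2 (hg hν').2 (hg hμ).1 (hg hν').1 e)
    · exact fun h => (h hν').elim
  rwa [hg0, zero_add]

lemma isSymmetric_esymmEval (f : MvPolynomial ℕ k) : (esymmEval k n f).IsSymmetric := by
  rw [← esymmAlgHom_dehomogenize]
  exact (esymmAlgHom (Fin n) k n (dehomogenize k n f)).2

lemma exists_esymmEval_eq {f : MvPolynomial (Fin n) k} (hf : f.IsSymmetric) :
    ∃ g, esymmEval k n g = f := by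
  obtain ⟨q, hq⟩ := esymmAlgHom_fin_surjective k (le_refl n) ⟨f, hf⟩
  refine ⟨rename (fun i : Fin n => (i : ℕ) + 1) q, ?_⟩
  rw [esymmEval, aeval_rename]
  have := congrArg Subtype.val hq
  rwa [esymmAlgHom_apply] at this

/-- Homogenization with respect to `X 0`. -/
lemma eventually_exists_homogeneous_lift {p a : ℕ} {Q : Set (ℕ →₀ ℕ)}
    (hQ : ∀ μ ∈ Q, ∀ r, p ∣ μ.degree + r + a → μ + Finsupp.single 0 r ∈ Q)
    {f : MvPolynomial ℕ k} (hf : f ∈ restrictSupport k Q) :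
    ∀ᶠ N in Filter.atTop, p ∣ N + a →
      ∃ g ∈ restrictSupport k ({μ | μ.degree = N} ∩ Q), esymmEval k n g = esymmEval k n f := by
  rw [restrictSupport_eq_span] at hf
  induction hf using Submodule.span_induction with
  | zero => exact Filter.Eventually.of_forall fun N _ => ⟨0, Submodule.zero_mem _, rfl⟩
  | add x y _ _ hx hy =>
    filter_upwards [hx, hy] with N hx hy hN
    obtain ⟨g, hg, e⟩ := hx hN
    obtain ⟨g', hg', e'⟩ := hy hN
    exact ⟨g + g', Submodule.add_mem _ hg hg', by rw [map_add, map_add, e, e']⟩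
  | smul r x _ hx =>
    filter_upwards [hx] with N hx hN
    obtain ⟨g, hg, e⟩ := hx hN
    exact ⟨r • g, Submodule.smul_mem _ _ hg, by rw [map_smul, map_smul, e]⟩
  | mem x hx =>
    obtain ⟨μ, hμ, rfl⟩ := hx
    filter_upwards [Filter.eventually_ge_atTop μ.degree] with N hle hN
    refine ⟨monomial (μ + Finsupp.single 0 (N - μ.degree)) 1, ?_, ?_⟩
    · rw [monomial_mem_restrictSupport]
      refine Or.inl ⟨?_, hQ μ hμ _ (by rwa [Nat.add_sub_cancel' hle])⟩
      rw [Set.mem_ofPred_eq, map_add, Finsupp.degree_single, Nat.add_sub_cancel' hle]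
    · rw [esymmEval_monomial_add, esymmEval_single, esymm_zero, one_pow, mul_one]

end EsymmEval

section SmallSubcomplex

variable {k : Type*} [Field k] {p c n a : ℕ}

variable (k p c n a) in
/-- The image in the symmetric polynomials of the span of the core monomials. -/
noncomputable def coreSpan : Submodule k (MvPolynomial (Fin n) k) :=
  (restrictSupport k {μ | CoreExponent p c n a μ}).map (esymmEval k n).toLinearMap

lemma esymmEval_mem_coreSpan {f : MvPolynomial ℕ k}
    (hf : f ∈ restrictSupport k {μ | CoreExponent p c n a μ}) :
    esymmEval k n f ∈ coreSpan k p c n a :=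
  Submodule.mem_map_of_mem (f := (esymmEval k n).toLinearMap) hf

lemma esymmEval_mem_coreSpan_of_mem_smallExponents {N : ℕ} {f : MvPolynomial ℕ k}
    (hf : f ∈ restrictSupport k ({μ | μ.degree = N} ∩ smallExponents p c n a)) :
    esymmEval k n f ∈ coreSpan k p c n a := by
  obtain ⟨g, hg, h, hh, rfl⟩ := exists_add_of_mem_restrictSupport
    (restrictSupport_mono k Set.inter_subset_right hf)
  rw [map_add, esymmEval_eq_zero_of_mem_tailExponents hh, add_zero]
  exact esymmEval_mem_coreSpan hg

lemma esymm_pow_mul_mem_coreSpan {j : ℕ} (hj : j ≤ c) {w : MvPolynomial (Fin n) k}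
    (hw : w ∈ coreSpan k p c n a) : esymm (Fin n) k (j * p) ^ p * w ∈ coreSpan k p c n a := by
  obtain ⟨f, hf, rfl⟩ := hw
  rw [← esymmEval_single, AlgHom.toLinearMap_apply, ← map_mul]
  refine esymmEval_mem_coreSpan (monomial_mul_mem_restrictSupport (fun μ hμ => ?_) hf)
  rw [Set.mem_ofPred_eq, add_comm]
  exact .step j μ hj hμ

lemma mul_mem_coreSpan {b w : MvPolynomial (Fin n) k}
    (hb : b ∈ Algebra.adjoin k
      {f | ∃ j : ℕ, 1 ≤ j ∧ j ≤ c ∧ f = esymm (Fin n) k (j * p) ^ p})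
    (hw : w ∈ coreSpan k p c n a) : b * w ∈ coreSpan k p c n a := by
  induction hb using Algebra.adjoin_induction generalizing w with
  | mem x hx =>
    obtain ⟨j, -, hj, rfl⟩ := hx
    exact esymm_pow_mul_mem_coreSpan hj hw
  | algebraMap r => rw [← Algebra.smul_def]; exact Submodule.smul_mem _ _ hw
  | add x y _ _ hx hy => rw [add_mul]; exact Submodule.add_mem _ (hx hw) (hy hw)
  | mul x y _ _ hx hy => rw [mul_assoc]; exact hx (hy hw)

lemma esymmEval_monomial_sum (i : Fin (n + 1 - c * p) → ℕ) :
    esymmEval k n (monomial (∑ t : Fin (n + 1 - c * p), Finsupp.single (c * p + (t : ℕ)) (i t)) 1)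
      = ∏ t : Fin (n + 1 - c * p), esymm (Fin n) k (c * p + (t : ℕ)) ^ i t := by
  rw [monomial_sum_one, map_prod]
  exact Finset.prod_congr rfl fun t _ => esymmEval_single _ _

lemma coreExponent_sum {i : Fin (n + 1 - c * p) → ℕ} (hi : ∑ t, i t = p - a) :
    CoreExponent p c n a (∑ t : Fin (n + 1 - c * p), Finsupp.single (c * p + (t : ℕ)) (i t)) := by
  refine .base _ (fun z hz => ?_) (by simpa using hi)
  rw [Finsupp.finsetSum_apply] at hz
  obtain ⟨t, -, ht⟩ := Finset.exists_ne_zero_of_sum_ne_zero hz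
  have : c * p + (t : ℕ) = z := by
    by_contra hne
    simp [hne] at ht
  omega

lemma eq_sum_single_of_support {μ : ℕ →₀ ℕ} (h : ∀ i, μ i ≠ 0 → c * p ≤ i ∧ i ≤ n) :
    ∑ t : Fin (n + 1 - c * p), Finsupp.single (c * p + (t : ℕ)) (μ (c * p + (t : ℕ))) = μ := by
  ext z
  rw [Finsupp.finsetSum_apply]
  by_cases hz : μ z = 0
  · rw [hz]
    refine Finset.sum_eq_zero fun t _ => ?_
    rw [Finsupp.single_apply]
    split_ifs with h
    · rw [h, hz]
    · rfl
  · obtain ⟨h1, h2⟩ := h z hz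
    rw [Finset.sum_eq_single ⟨z - c * p, by omega⟩]
    · simp [Nat.add_sub_cancel' h1]
    · intro t _ ht
      rw [Finsupp.single_apply, if_neg]
      intro e
      exact ht (Fin.ext (by simp only; omega))
    · simp

/-- The small subcomplex is the span over the subalgebra generated by the `e_{jp} ^ p` of the
monomials of degree `p - a` in `e_{cp}, …, e_n`. -/
lemma span_eq_coreSpan :
    Submodule.span k {f | ∃ g ∈ Algebra.adjoin k
          {f | ∃ j : ℕ, 1 ≤ j ∧ j ≤ c ∧ f = esymm (Fin n) k (j * p) ^ p},
        ∃ i : Fin (n + 1 - c * p) → ℕ, (∑ t, i t = p - a) ∧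
        f = g * ∏ t : Fin (n + 1 - c * p), esymm (Fin n) k (c * p + (t : ℕ)) ^ i t}
      = coreSpan k p c n a := by
  refine le_antisymm (Submodule.span_le.2 ?_) ?_
  · rintro f ⟨g, hg, i, hi, rfl⟩
    refine mul_mem_coreSpan hg ?_
    rw [← esymmEval_monomial_sum]
    exact esymmEval_mem_coreSpan (by simp [coreExponent_sum hi])
  · rw [coreSpan, restrictSupport_eq_span, Submodule.map_span, Submodule.span_le]
    rintro _ ⟨_, ⟨μ, hμ, rfl⟩, rfl⟩
    refine Submodule.subset_span ?_
    rw [AlgHom.toLinearMap_apply]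
    induction hμ with
    | base μ h hdeg =>
      refine ⟨1, Subalgebra.one_mem _, fun t => μ (c * p + t), ?_, ?_⟩
      · rw [← hdeg]
        conv_rhs => rw [← eq_sum_single_of_support h]
        simp
      · rw [one_mul, ← esymmEval_monomial_sum, eq_sum_single_of_support h]
    | step j μ hj _ ih =>
      obtain ⟨g, hg, i, hi, e⟩ := ih
      rw [esymmEval_monomial_add, esymmEval_single, e]
      rcases Nat.eq_zero_or_pos j with rfl | hj0
      · rw [zero_mul, esymm_zero, one_pow, mul_one]
        exact ⟨g, hg, i, hi, rfl⟩
      · exact ⟨g * esymm (Fin n) k (j * p) ^ p,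
          mul_mem hg (Algebra.subset_adjoin ⟨j, hj0, hj, rfl⟩), i, hi, by ring⟩

lemma CoreExponent.add_single_zero {μ : ℕ →₀ ℕ} (h : CoreExponent p c n a μ) (ha : a ≤ p) {r : ℕ}
    (hr : p ∣ μ.degree + r + a) : CoreExponent p c n a (μ + Finsupp.single 0 r) := by
  rw [add_right_comm] at hr
  obtain ⟨q, rfl⟩ := (Nat.dvd_add_right (h.dvd_degree ha)).1 hr
  clear hr
  induction q with
  | zero => simpa using h
  | succ q ih =>
    have := CoreExponent.step 0 _ (Nat.zero_le c) ih
    rwa [zero_mul, add_assoc, ← Finsupp.single_add] at this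

lemma frequently_dvd_add (hp : 0 < p) (a : ℕ) : ∃ᶠ N in Filter.atTop, p ∣ N + a := by
  refine Filter.frequently_atTop.2 fun M => ⟨p * (M + a) - a, ?_, ?_⟩
  · have := Nat.le_mul_of_pos_left (M + a) hp
    omega
  · have := Nat.le_mul_of_pos_left (M + a) hp
    rw [Nat.sub_add_cancel (by omega)]
    exact dvd_mul_right _ _

lemma eventually_exists_symmetric_lift {f : MvPolynomial (Fin n) k} (hf : f.IsSymmetric) :
    ∀ᶠ N in Filter.atTop, p ∣ N + a →
      ∃ g ∈ restrictSupport k {μ | μ.degree = N}, esymmEval k n g = f := by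
  obtain ⟨g, rfl⟩ := exists_esymmEval_eq hf
  have hg : g ∈ restrictSupport k Set.univ := (mem_restrictSupport_iff k).2 (Set.subset_univ _)
  simpa only [Set.inter_univ] using
    eventually_exists_homogeneous_lift (p := p) (a := a) (n := n)
      (fun _ _ _ _ => Set.mem_univ _) hg

lemma eventually_exists_core_lift (ha : a ≤ p) {w : MvPolynomial (Fin n) k}
    (hw : w ∈ coreSpan k p c n a) :
    ∀ᶠ N in Filter.atTop, p ∣ N + a →
      ∃ g ∈ restrictSupport k ({μ | μ.degree = N} ∩ {μ | CoreExponent p c n a μ}),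
        esymmEval k n g = w := by
  obtain ⟨f, hf, rfl⟩ := hw
  exact eventually_exists_homogeneous_lift (fun μ hμ r hr => hμ.add_single_zero ha hr) hf

variable {D : Derivation k (MvPolynomial (Fin n) k) (MvPolynomial (Fin n) k)}

lemma exists_symmetric_lift (hp : 0 < p) (a : ℕ) {f : MvPolynomial (Fin n) k}
    (hf : f.IsSymmetric) :
    ∃ N, p ∣ N + a ∧ ∃ g ∈ restrictSupport k {μ | μ.degree = N}, esymmEval k n g = f := by
  obtain ⟨N, hN, h⟩ := ((frequently_dvd_add hp a).and_eventually
    (eventually_exists_symmetric_lift (p := p) (a := a) hf)).exists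
  exact ⟨N, hN, h hN⟩

lemma twistedEnd_isSymmetric [CharP k p] (hp : 0 < p) (hD : ∀ i, D (X i) = X i ^ 2)
    {f : MvPolynomial (Fin n) k} (hf : f.IsSymmetric) : (twistedEnd D a f).IsSymmetric := by
  obtain ⟨N, hN, g, hg, rfl⟩ := exists_symmetric_lift hp a hf
  rw [twistedEnd_esymmEval hD hN hg]
  exact isSymmetric_esymmEval _

lemma twistedEnd_pow_char [Fact p.Prime] [CharP k p] (hD : ∀ i, D (X i) = X i ^ 2)
    {f : MvPolynomial (Fin n) k} (hf : f.IsSymmetric) : (twistedEnd D a ^ p) f = 0 := by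
  obtain ⟨N, hN, g, hg, rfl⟩ := exists_symmetric_lift (Fact.out : p.Prime).pos a hf
  rw [twistedEnd_pow_esymmEval hD hN p hg, shiftEnd_pow_char, LinearMap.zero_apply, map_zero]

lemma twistedEnd_mem_coreSpan [Fact p.Prime] [CharP k p] (hD : ∀ i, D (X i) = X i ^ 2)
    (ha : a ≤ p) {w : MvPolynomial (Fin n) k} (hw : w ∈ coreSpan k p c n a) :
    twistedEnd D a w ∈ coreSpan k p c n a := by
  obtain ⟨N, hN, h⟩ := ((frequently_dvd_add (Fact.out : p.Prime).pos a).and_eventually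
    (eventually_exists_core_lift ha hw)).exists
  obtain ⟨g, hg, rfl⟩ := h hN
  have hg' := restrictSupport_mono k Set.inter_subset_left hg
  rw [twistedEnd_esymmEval hD hN hg']
  refine esymmEval_mem_coreSpan_of_mem_smallExponents (N := N)
    (shiftDerivation_mem_restrictSupport (fun μ i hμ h1 _ => ?_) hg)
  refine ⟨?_, CoreExponent.shift hμ.2 h1⟩
  simpa only [Set.mem_ofPred_eq, map_add, Finsupp.degree_single] using hμ.1

/-- The symmetric polynomials modulo the small subcomplex form an acyclic `p`-complex. -/
theorem relAcyclic_coreSpan [Fact p.Prime] [CharP k p] (hD : ∀ i, D (X i) = X i ^ 2)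
    (hcn : c * p ≤ n) (hna : n + 1 ≤ c * p + a) (ha : a < p) :
    RelAcyclic p (twistedEnd D a) (coreSpan k p c n a)
      (Subalgebra.toSubmodule (symmetricSubalgebra (Fin n) k)) := by
  intro f hf hfW
  obtain ⟨N, hN, h₁, h₂⟩ := ((frequently_dvd_add (Fact.out : p.Prime).pos a).and_eventually
    ((eventually_exists_symmetric_lift (p := p) (a := a) hf).and
      (eventually_exists_core_lift ha.le hfW))).exists
  obtain ⟨g, hg, rfl⟩ := h₁ hN
  obtain ⟨w, hw, e⟩ := h₂ hN
  rw [twistedEnd_esymmEval hD hN hg] at e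
  have hδg := shiftEnd_mem_degree g hg
  have hdiff : shiftEnd k g - w ∈ restrictSupport k {μ | μ.degree = N} :=
    Submodule.sub_mem _ hδg (restrictSupport_mono k Set.inter_subset_left hw)
  have htail := mem_tailExponents_of_esymmEval_eq_zero (n := n) hdiff
    (by rw [map_sub, e, sub_self])
  have hsmall : shiftEnd k g ∈
      restrictSupport k ({μ | μ.degree = N} ∩ smallExponents p c n a) := by
    have h1 : shiftEnd k g - w ∈ restrictSupport k (smallExponents p c n a) :=
      restrictSupport_mono k Set.subset_union_right htail
    have h2 : w ∈ restrictSupport k (smallExponents p c n a) :=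
      restrictSupport_mono k (Set.inter_subset_right.trans Set.subset_union_left) hw
    have h3 := Submodule.add_mem _ h1 h2
    rw [sub_add_cancel] at h3
    rw [mem_restrictSupport_iff] at h3 hδg ⊢
    exact Set.subset_inter hδg h3
  obtain ⟨u, hu, hgu⟩ := relAcyclic_smallExponents hcn hna ha hN g hg hsmall
  refine ⟨esymmEval k n u, isSymmetric_esymmEval u, ?_⟩
  rw [twistedEnd_pow_esymmEval hD hN _ hu, ← map_sub]
  exact esymmEval_mem_coreSpan_of_mem_smallExponents hgu

end SmallSubcomplex

/-- For `c ≥ 1`, `cp ≤ n ≤ (c+1)p − 1` and `n − cp + 1 ≤ a ≤ p − 1`: the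
`B_c`-span `W` of the monomials `e_{cp}^{i_{cp}} ⋯ e_n^{i_n}` with
`i_{cp} + ⋯ + i_n = p − a` is stable under the twisted differential
`D_a(f) = ∂(f) + a·e_1·f`, and the inclusion `(W, D_a) ↪ (Sym_n, D_a)` is a
quasi-isomorphism of `p`-complexes. -/
theorem stmt12 (p : ℕ) (hp : p.Prime) (k : Type*) [Field k] [CharP k p]
    (c n a : ℕ) (hc : 1 ≤ c) (hcn : c * p ≤ n) (hnc : n ≤ (c + 1) * p - 1)
    (ha1 : n - c * p + 1 ≤ a) (ha2 : a ≤ p - 1)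
    (D : Derivation k (MvPolynomial (Fin n) k) (MvPolynomial (Fin n) k))
    (hD : ∀ i, D (X i) = X i ^ 2)
    (Da : MvPolynomial (Fin n) k → MvPolynomial (Fin n) k)
    (hDa : ∀ f, Da f = D f + (a : MvPolynomial (Fin n) k) * (esymm (Fin n) k 1 * f))
    (B : Subalgebra k (MvPolynomial (Fin n) k))
    (hB : B = Algebra.adjoin k
      {f | ∃ j : ℕ, 1 ≤ j ∧ j ≤ c ∧ f = esymm (Fin n) k (j * p) ^ p})
    (W : Submodule k (MvPolynomial (Fin n) k))
    (hW : W = Submodule.span k {f | ∃ g ∈ B, ∃ i : Fin (n + 1 - c * p) → ℕ,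
        (∑ t, i t = p - a) ∧
        f = g * ∏ t : Fin (n + 1 - c * p), esymm (Fin n) k (c * p + (t : ℕ)) ^ i t}) :
    (∀ f ∈ W, Da f ∈ W) ∧
    ∀ s : ℕ, 1 ≤ s → s ≤ p - 1 →
      (∀ f : MvPolynomial (Fin n) k, f.IsSymmetric → Da^[s] f = 0 →
        ∃ w ∈ W, Da^[s] w = 0 ∧
          ∃ h : MvPolynomial (Fin n) k, h.IsSymmetric ∧ f = w + Da^[p - s] h) ∧
      (∀ w ∈ W, Da^[s] w = 0 →
        (∃ h : MvPolynomial (Fin n) k, h.IsSymmetric ∧ Da^[p - s] h = w) →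
        ∃ h' ∈ W, Da^[p - s] h' = w) := by
  have : Fact p.Prime := ⟨hp⟩
  have hp0 := hp.pos
  rw [hB, span_eq_coreSpan] at hW
  subst hW
  obtain rfl : Da = twistedEnd D a := funext fun f => by rw [hDa, twistedEnd_apply]
  have hrel := relAcyclic_coreSpan (k := k) (p := p) hD hcn (by omega) (by omega : a < p)
  have hsymm : ∀ f ∈ Subalgebra.toSubmodule (symmetricSubalgebra (Fin n) k),
      twistedEnd D a f ∈ Subalgebra.toSubmodule (symmetricSubalgebra (Fin n) k) :=
    fun f hf => twistedEnd_isSymmetric hp0 hD hf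
  refine ⟨fun f hf => twistedEnd_mem_coreSpan hD (by omega) hf, fun s hs1 hs2 => ⟨?_, ?_⟩⟩
  · intro f hf hf0
    rw [← Module.End.pow_apply] at hf0
    obtain ⟨h, hh, hW⟩ := hrel.exists_sub_mem hsymm s hs2 (f := f) hf
      (by rw [hf0]; exact Submodule.zero_mem _)
    refine ⟨_, hW, ?_, h, hh, ?_⟩
    · rw [← Module.End.pow_apply, map_sub, hf0, ← Module.End.mul_apply, ← pow_add,
        Nat.add_sub_cancel' (by omega), twistedEnd_pow_char hD hh, sub_zero]
    · rw [← Module.End.pow_apply, sub_add_cancel]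
  · rintro w hw - ⟨h, hh, rfl⟩
    rw [← Module.End.pow_apply] at hw ⊢
    obtain ⟨u, hu, hW⟩ := hrel.exists_sub_mem hsymm (p - s) (by omega) (f := h) hh hw
    refine ⟨_, hW, ?_⟩
    rw [← Module.End.pow_apply, map_sub, ← Module.End.mul_apply, ← pow_add,
      Nat.add_sub_cancel' (by omega), twistedEnd_pow_char hD hu, sub_zero]
end

section
/- (Iterates of the induced differential on the image of a subquotient idempotent.) Let A be an associative unital ring and d : A → A an additive map satisfying the Leibniz rule d(xy) = d(x)·y + x·d(y) for all x, y ∈ A. Let ε, ω ∈ A be idempotents (ε² = ε, ω² = ω) with ω·ε = ε·ω = ε, ω·d(ω) = 0, and (ω − ε)·d(ω − ε) = 0 (i.e., ε is a subquotient idempotent dominated by ω). Then for every a ∈ A and every m ∈ ℕ, the m-fold iterate of the map x ↦ d(x)·ε, applied to a·ε, equals d^m(a·ε)·ε. In particular, if d^p = 0 then the induced differential x ↦ d(x)·ε on the right ideal A·ε also has vanishing p-th iterate. -/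
/-- If `η * d η = 0`, then the set of `x` with `x * η = x` is stable under the Leibniz map `d`. -/
theorem leibniz_mul_eq_of_mul_eq {A : Type*} [Ring A] {d : A → A}
    (hleib : ∀ x y : A, d (x * y) = d x * y + x * d y)
    {η x : A} (hη : η * d η = 0) (hx : x * η = x) : d x * η = d x := by
  have h := hleib x η
  have hz : x * d η = 0 := by rw [← hx, mul_assoc, hη, mul_zero]
  rw [hx, hz, add_zero] at h
  exact h.symm

/-- Iterates of the induced differential on the image of a subquotient idempotent:
if `ε` is a subquotient idempotent dominated by `ω` in a ring with an additive
Leibniz map `d`, then the `m`-fold iterate of `x ↦ d(x)·ε` applied to `a·ε` equals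
`d^m(a·ε)·ε`; in particular `d^p = 0` forces the induced differential on `A·ε` to
have vanishing `p`-th iterate. -/
theorem stmt18 (A : Type*) [Ring A] (d : A → A)
    (hadd : ∀ x y : A, d (x + y) = d x + d y)
    (hleib : ∀ x y : A, d (x * y) = d x * y + x * d y)
    (ε ω : A) (hε : ε * ε = ε) (hω : ω * ω = ω)
    (hωε : ω * ε = ε) (hεω : ε * ω = ε)
    (h1 : ω * d ω = 0) (h2 : (ω - ε) * d (ω - ε) = 0) :
    (∀ (a : A) (m : ℕ), (fun x => d x * ε)^[m] (a * ε) = d^[m] (a * ε) * ε) ∧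
    (∀ p : ℕ, (∀ x : A, d^[p] x = 0) →
      ∀ a : A, (fun x => d x * ε)^[p] (a * ε) = 0) := by
  have hν : (ω - ε) * (ω - ε) = ω - ε := by
    rw [mul_sub, sub_mul, sub_mul, hω, hεω, hωε, hε, sub_self, sub_zero]
  have hνε : (ω - ε) * ε = 0 := by rw [sub_mul, hωε, hε, sub_self]
  have hstable : ∀ (a : A) (m : ℕ), d^[m] (a * ε) * ω = d^[m] (a * ε) := by
    intro a m
    induction m with
    | zero => simp [mul_assoc, hεω]
    | succ m ih =>
      rw [Function.iterate_succ_apply']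
      exact leibniz_mul_eq_of_mul_eq hleib h1 ih
  have hiter : ∀ (a : A) (m : ℕ),
      (fun x => d x * ε)^[m] (a * ε) = d^[m] (a * ε) * ε := by
    intro a m
    induction m with
    | zero => simp [mul_assoc, hε]
    | succ m ih =>
      rw [Function.iterate_succ_apply', Function.iterate_succ_apply', ih]
      set y := d^[m] (a * ε)
      have hy : y = y * ε + y * (ω - ε) := by
        rw [← mul_add, add_sub_cancel, hstable a m]
      have hyν : d (y * (ω - ε)) * ε = 0 := by
        rw [← leibniz_mul_eq_of_mul_eq hleib h2 (x := y * (ω - ε))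
          (by rw [mul_assoc, hν]), mul_assoc, hνε, mul_zero]
      have hdy := congrArg (fun z => d z * ε) hy
      simp only [hadd, add_mul, hyν, add_zero] at hdy
      exact hdy.symm
  exact ⟨hiter, fun p hp a => by rw [hiter, hp, zero_mul]⟩
end

section
/- (p-nilpotency criterion for the twisted differential.) Let k be a field of characteristic p (p prime), n ≥ 1, and a ∈ k. Consider the twisted differential D_a : Sym_n → Sym_n on the algebra of symmetric polynomials in k[x_0,…,x_{n−1}], defined by D_a(f) = ∂(f) + a·e_1·f. Then D_a^p = 0 if and only if a lies in the prime subfield 𝔽_p of k, i.e., if and only if a^p = a. -/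
open MvPolynomial

namespace Derivation

variable {R A : Type*} [CommSemiring R] [CommSemiring A] [Algebra R A]

/-- The general Leibniz rule for iterates of a derivation. -/
theorem iterate_mul (D : Derivation R A A) (n : ℕ) (f g : A) :
    D^[n] (f * g) =
      ∑ ij ∈ Finset.HasAntidiagonal.antidiagonal n, n.choose ij.1 • (D^[ij.1] f * D^[ij.2] g) := by
  induction n with
  | zero => simp
  | succ n ih =>
    rw [Finset.sum_antidiagonal_choose_succ_nsmul (fun i j => D^[i] f * D^[j] g) n]
    simp only [Function.iterate_succ_apply', ih, map_sum, map_nsmul, leibniz, smul_eq_mul,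
      smul_add, Finset.sum_add_distrib]
    congr 1
    refine Finset.sum_congr rfl fun ij hij => ?_
    rw [n.choose_symm_of_eq_add (Finset.HasAntidiagonal.mem_antidiagonal.1 hij).symm, mul_comm]

/-- In characteristic `p`, the `p`-th iterate of a derivation satisfies the Leibniz rule. -/
theorem iterate_prime_mul {p : ℕ} (hp : p.Prime) [CharP A p] (D : Derivation R A A) (f g : A) :
    D^[p] (f * g) = f * D^[p] g + D^[p] f * g := by
  rw [iterate_mul, Finset.Nat.sum_antidiagonal_eq_sum_range_succ_mk, Finset.sum_range_succ,
    Finset.sum_eq_single_of_mem 0 (Finset.mem_range.2 hp.pos)]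
  · simp
  · intro j hj hj0
    rw [nsmul_eq_mul, (CharP.cast_eq_zero_iff A p _).2
      (hp.dvd_choose_self hj0 (Finset.mem_range.1 hj)), zero_mul]

end Derivation

section SquareDerivation

variable {σ k : Type*} [Field k]
  {D : Derivation k (MvPolynomial σ k) (MvPolynomial σ k)}

theorem iterate_derivation_X (hD : ∀ i, D (X i) = X i ^ 2) (m : ℕ) (i : σ) :
    D^[m] (X i) = m.factorial • X i ^ (m + 1) := by
  induction m with
  | zero => simp
  | succ m ih =>
    rw [Function.iterate_succ_apply', ih, map_nsmul, D.leibniz_pow, hD, Nat.factorial_succ,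
      Nat.add_sub_cancel]
    simp only [nsmul_eq_mul, smul_eq_mul]
    push_cast
    ring

theorem iterate_prime_derivation_eq_zero {p : ℕ} (hp : p.Prime) [CharP k p]
    (hD : ∀ i, D (X i) = X i ^ 2) (f : MvPolynomial σ k) : D^[p] f = 0 := by
  induction f using MvPolynomial.induction_on with
  | C a =>
    obtain ⟨q, rfl⟩ := Nat.exists_eq_succ_of_ne_zero hp.ne_zero
    rw [Function.iterate_succ_apply, derivation_C, iterate_map_zero]
  | add f g hf hg => rw [iterate_map_add, hf, hg, add_zero]
  | mul_X f i hf =>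
    rw [D.iterate_prime_mul hp, hf, iterate_derivation_X hD, nsmul_eq_mul,
      (CharP.cast_eq_zero_iff (MvPolynomial σ k) p _).2 (Nat.dvd_factorial hp.pos le_rfl)]
    simp

theorem derivation_prod_X (hD : ∀ i, D (X i) = X i ^ 2) (s : Finset σ) :
    D (∏ i ∈ s, X i) = (∑ i ∈ s, X i) * ∏ i ∈ s, X i := by
  classical
  induction s using Finset.induction_on with
  | empty => simp
  | insert i s hi ih =>
    rw [Finset.prod_insert hi, Finset.sum_insert hi, D.leibniz, ih, hD]
    simp only [smul_eq_mul]
    ring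

theorem derivation_prod_X_pow (hD : ∀ i, D (X i) = X i ^ 2) (s : Finset σ) (m : ℕ) :
    D ((∏ i ∈ s, X i) ^ m) = (m : MvPolynomial σ k) * (∑ i ∈ s, X i) * (∏ i ∈ s, X i) ^ m := by
  induction m with
  | zero => simp
  | succ m ih =>
    rw [pow_succ, D.leibniz, ih, derivation_prod_X hD]
    simp only [smul_eq_mul]
    push_cast
    ring

/-- Restriction to a coordinate axis intertwines `∂` with `t² d/dt`. -/
theorem aeval_single_derivation [DecidableEq σ] (hD : ∀ i, D (X i) = X i ^ 2) (i : σ)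
    (f : MvPolynomial σ k) :
    aeval (Pi.single i (Polynomial.X : Polynomial k)) (D f) =
      Polynomial.X ^ 2 *
        Polynomial.derivative (aeval (Pi.single i (Polynomial.X : Polynomial k)) f) := by
  induction f using MvPolynomial.induction_on with
  | C a => simp [Polynomial.algebraMap_eq]
  | add f g hf hg => simp only [map_add, hf, hg, mul_add]
  | mul_X f j hf =>
    simp only [D.leibniz, hD, smul_eq_mul, map_add, map_mul, map_pow, aeval_X, hf,
      Polynomial.derivative_mul]
    obtain rfl | hij := eq_or_ne j i
    · simp only [Pi.single_eq_same, Polynomial.derivative_X]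
      ring
    · simp [Pi.single_eq_of_ne hij]

end SquareDerivation

theorem exists_natCast_eq_of_pow_char_eq {k : Type*} [Field k] {p : ℕ} (hp : p.Prime) [CharP k p]
    {a : k} (ha : a ^ p = a) : ∃ m : ℕ, (m : k) = a := by
  have : Fact p.Prime := ⟨hp⟩
  have hmem : a ∈ (⊥ : Subfield k) := (Subfield.mem_bot_iff_pow_eq_self k p).2 ha
  rw [← ZMod.fieldRange_castHom_eq_bot p] at hmem
  obtain ⟨z, rfl⟩ := hmem
  exact ⟨z.val, by simp⟩

theorem pow_char_eq_of_prod_add_natCast_eq_zero {k : Type*} [Field k] {p : ℕ} (hp : p.Prime)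
    [CharP k p] {a : k} {m : ℕ} (h : ∏ j ∈ Finset.range m, (a + j) = 0) : a ^ p = a := by
  have : Fact p.Prime := ⟨hp⟩
  obtain ⟨j, -, hj⟩ := Finset.prod_eq_zero_iff.1 h
  rw [← Subfield.mem_bot_iff_pow_eq_self k p, eq_neg_of_add_eq_zero_left hj]
  exact neg_mem (natCast_mem _ j)

/-- `p`-nilpotency criterion for the twisted differential: for `a ∈ k`, the twisted
differential `D_a(f) = ∂(f) + a·e_1·f` on symmetric polynomials in `n ≥ 1` variables
satisfies `D_a^p = 0` if and only if `a` lies in the prime subfield, i.e. `a^p = a`. -/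
theorem stmt19 (p : ℕ) (hp : p.Prime) (k : Type*) [Field k] [CharP k p]
    (n : ℕ) (hn : 1 ≤ n) (a : k)
    (D : Derivation k (MvPolynomial (Fin n) k) (MvPolynomial (Fin n) k))
    (hD : ∀ i, D (X i) = X i ^ 2)
    (Da : MvPolynomial (Fin n) k → MvPolynomial (Fin n) k)
    (hDa : ∀ f, Da f = D f + C a * (esymm (Fin n) k 1 * f)) :
    (∀ f : MvPolynomial (Fin n) k, f.IsSymmetric → Da^[p] f = 0) ↔ a ^ p = a := by
  rw [esymm_one] at hDa
  constructor
  · intro h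
    let i : Fin n := ⟨0, hn⟩
    let π := aeval (R := k) (Pi.single i (Polynomial.X : Polynomial k))
    have hπ : π (∑ j, X j) = Polynomial.X := by simp [π, map_sum]
    have key (m : ℕ) : π (Da^[m] 1) =
        Polynomial.C (∏ j ∈ Finset.range m, (a + j)) * Polynomial.X ^ m := by
      induction m with
      | zero => simp
      | succ m ih =>
        have hDπ : π (D (Da^[m] 1)) = Polynomial.X ^ 2 * Polynomial.derivative (π (Da^[m] 1)) :=
          aeval_single_derivation hD i _
        have hC : π (C a) = Polynomial.C a := by simp [π, Polynomial.algebraMap_eq]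
        rw [Function.iterate_succ_apply', hDa, map_add, map_mul, map_mul, hDπ, ih, hπ, hC,
          Finset.prod_range_succ, Polynomial.derivative_C_mul, Polynomial.derivative_X_pow]
        cases m with
        | zero => simp
        | succ m =>
          simp only [map_mul, map_add, map_natCast, Nat.add_sub_cancel]
          ring
    have hzero := key p
    rw [h 1 IsSymmetric.one, map_zero] at hzero
    refine pow_char_eq_of_prod_add_natCast_eq_zero hp (m := p) ?_
    exact Polynomial.C_eq_zero.1
      ((mul_eq_zero.1 hzero.symm).resolve_right (pow_ne_zero _ Polynomial.X_ne_zero))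
  · intro ha f _
    obtain ⟨m, rfl⟩ := exists_natCast_eq_of_pow_char_eq hp ha
    let u : MvPolynomial (Fin n) k := (∏ i, X i) ^ m
    have hu : u ≠ 0 := pow_ne_zero _ (Finset.prod_ne_zero_iff.2 fun i _ => X_ne_zero i)
    have hconj : Function.Semiconj (u * ·) Da D := fun g => by
      simp only [u, hDa, D.leibniz, derivation_prod_X_pow hD, smul_eq_mul, map_natCast]
      ring
    refine (mul_eq_zero.1 ?_).resolve_left hu
    exact (hconj.iterate_right p f).trans (iterate_prime_derivation_eq_zero hp hD _)
end
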